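/- arXiv:1507.02124 — 2 statements merged into one kernel-verified Lean document; each statement's English description precedes it below -/
import Mathlib

section
/- Let φ(x) = e^{−πx²}, let n ≥ 1, a_1, …, a_n, b_1, …, b_n ∈ ℝ, d_1, …, d_n ∈ ℂ, and suppose g = ∑_{j=1}^n d_j M_{b_j} T_{a_j} φ is not identically zero, where M_b T_a φ(x) = e^{2πib x} φ(x − a). If α, β > 0 are such that αβ is rational and αβ ≤ 1, then the Gabor system G(g, α, β) is complete in L²(ℝ). -/
open MeasureTheory Complex Real

/-- The Gabor system `G(g, α, β)` is complete in `L²(ℝ)`: the finite linear span of the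
time-frequency shifts `x ↦ e^{2πiβlx} g(x − αk)`, `k, l ∈ ℤ`, is dense in `L²(ℝ, ℂ)`. -/
def GaborComplete (g : ℝ → ℂ) (α β : ℝ) : Prop :=
  (Submodule.span ℂ {h : Lp ℂ 2 (volume : Measure ℝ) |
      ∃ k l : ℤ, ∀ᵐ x : ℝ, h x =
        Complex.exp (2 * Real.pi * Complex.I * (β * l * x)) * g (x - α * k)}).topologicalClosure
    = ⊤

section

open Filter Topology

/-- Zeros of a holomorphic function can be divided out. -/
lemma exists_eq_prod_sub_mul {U : Set ℂ} (hU : IsOpen U) {f : ℂ → ℂ}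
    (hf : DifferentiableOn ℂ f U) (S : Finset ℂ) (hS : ∀ s ∈ S, s ∈ U ∧ f s = 0) :
    ∃ h : ℂ → ℂ, DifferentiableOn ℂ h U ∧ ∀ z, f z = (∏ s ∈ S, (z - s)) * h z := by
  induction S using Finset.induction_on with
  | empty => exact ⟨f, hf, by simp⟩
  | insert a S ha ih =>
    obtain ⟨h, hd, hfh⟩ := ih fun s hs => hS s (Finset.mem_insert_of_mem hs)
    obtain ⟨haU, hfa⟩ := hS a (Finset.mem_insert_self _ _)
    have h0 : h a = 0 := by
      rw [hfh, mul_eq_zero] at hfa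
      refine hfa.resolve_left (Finset.prod_ne_zero_iff.2 fun s hs => sub_ne_zero.2 ?_)
      rintro rfl
      exact ha hs
    refine ⟨dslope h a, (Complex.differentiableOn_dslope (hU.mem_nhds haU)).2 hd, fun z => ?_⟩
    have := sub_smul_dslope h a z
    rw [h0, sub_zero, smul_eq_mul] at this
    rw [hfh, ← this, Finset.prod_insert ha]
    ring

lemma summable_exp_neg_mul_int_sq {c : ℝ} (hc : 0 < c) :
    Summable fun m : ℤ => Real.exp (-c * (m : ℝ) ^ 2) := by
  have him : 0 < ((I * (c / π : ℝ) : ℂ)).im := by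
    simp only [mul_im, I_re, I_im, ofReal_re, ofReal_im]
    have := Real.pi_pos
    simp; positivity
  have := ((summable_jacobiTheta₂_term_iff 0 _).2 him).norm
  refine this.congr fun m => ?_
  rw [jacobiTheta₂_term, Complex.norm_exp]
  congr 1
  have hpi := Real.pi_ne_zero
  have : (2 * (π : ℂ) * I * m * 0 + π * I * m ^ 2 * (I * (c / π : ℝ))) =
    ((-c * (m : ℝ) ^ 2 : ℝ) : ℂ) := by
    push_cast
    have : (π : ℂ) ≠ 0 := by exact_mod_cast hpi
    field_simp
    ring_nf
    simp
  rw [this, ofReal_re]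

lemma prod_Icc_neg_succ {M : Type*} [CommMonoid M] (f : ℤ → M) (K : ℕ) :
    ∏ k ∈ Finset.Icc (-((K + 1 : ℕ) : ℤ)) ((K + 1 : ℕ) : ℤ), f k =
      f ((K + 1 : ℕ) : ℤ) * (f (-((K + 1 : ℕ) : ℤ)) * ∏ k ∈ Finset.Icc (-(K : ℤ)) K, f k) := by
  rw [← Finset.prod_insert, ← Finset.prod_insert]
  · congr 1
    ext k
    simp only [Finset.mem_Icc, Finset.mem_insert]
    push_cast
    omega
  · simp only [Finset.mem_Icc, Finset.mem_insert]
    push_cast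
    omega
  · simp only [Finset.mem_Icc]
    push_cast
    omega

lemma prod_Icc_neg_exp (L : ℝ) (K : ℕ) :
    ∏ k ∈ Finset.Icc (-(K : ℤ)) K, Real.exp (L * k) = 1 := by
  induction K with
  | zero => simp
  | succ K ih =>
    rw [prod_Icc_neg_succ, ih, mul_one, ← Real.exp_add]
    push_cast
    rw [show L * (K + 1) + L * (-(K + 1)) = 0 by ring, Real.exp_zero]

lemma prod_Icc_neg_exp_max (L : ℝ) (K : ℕ) :
    ∏ k ∈ Finset.Icc (-(K : ℤ)) K, Real.exp (L * max (k : ℝ) 0) =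
      Real.exp (L * (K * (K + 1) / 2)) := by
  induction K with
  | zero => simp
  | succ K ih =>
    rw [prod_Icc_neg_succ, ih, ← Real.exp_add, ← Real.exp_add]
    push_cast
    have h1 : (0 : ℝ) ≤ (K : ℝ) + 1 := by positivity
    rw [max_eq_left h1, max_eq_right (by linarith : -((K : ℝ) + 1) ≤ 0)]
    congr 1
    ring

/-- The Fourier coefficients of the product of an absolutely convergent Fourier series and an
integrable function are given by convolution. -/
lemma hasSum_fourierCoeff_tsum_mul {h : ℤ → ℂ} (hs : Summable h) {C : UnitAddCircle → ℂ}
    (hC : Integrable C AddCircle.haarAddCircle) (s : ℤ) :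
    HasSum (fun t => h t * fourierCoeff C (s - t))
      (fourierCoeff (fun a => (∑' t, h t * fourier t a) * C a) s) := by
  have key : ∀ t (a : UnitAddCircle), ‖h t * fourier (t - s) a * C a‖ = ‖h t‖ * ‖C a‖ := by
    intro t a
    rw [norm_mul, norm_mul, fourier_apply, Circle.norm_coe, mul_one]
  have hint : ∀ t, Integrable (fun a => h t * fourier (t - s) a * C a)
      AddCircle.haarAddCircle := by
    intro t
    refine (hC.norm.const_mul ‖h t‖).mono' ?_ (Filter.Eventually.of_forall fun a => (key t a).le)
    exact ((by fun_prop : Continuous fun a : UnitAddCircle => h t * fourier (t - s) a)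
      ).aestronglyMeasurable.mul hC.1
  have := hasSum_integral_of_summable_integral_norm (μ := AddCircle.haarAddCircle) hint (by
    simp_rw [key, integral_const_mul]
    exact hs.norm.mul_right _)
  have e1 : ∀ t, h t * fourierCoeff C (s - t) =
      ∫ a, h t * fourier (t - s) a * C a ∂AddCircle.haarAddCircle := by
    intro t
    rw [fourierCoeff, ← integral_const_mul]
    refine integral_congr_ae (Filter.Eventually.of_forall fun a => ?_)
    simp only [smul_eq_mul, neg_sub]
    ring
  have e2 : fourierCoeff (fun a => (∑' t, h t * fourier t a) * C a) s =
      ∫ a, ∑' t, h t * fourier (t - s) a * C a ∂AddCircle.haarAddCircle := by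
    rw [fourierCoeff]
    refine integral_congr_ae (Filter.Eventually.of_forall fun a => ?_)
    simp only [smul_eq_mul]
    rw [← tsum_mul_right, ← tsum_mul_left]
    refine tsum_congr fun t => ?_
    rw [sub_eq_add_neg, fourier_add]
    ring
  simp_rw [e1, e2]
  exact this

lemma eq_zero_of_tsum_fourier_eq_zero {h : ℤ → ℂ} (hs : Summable h)
    (h0 : ∀ a : UnitAddCircle, ∑' t, h t * fourier t a = 0) (m : ℤ) : h m = 0 := by
  have := hasSum_fourierCoeff_tsum_mul hs (C := fun _ => 1) (integrable_const _) m
  have hone : (fun _ : UnitAddCircle => (1 : ℂ)) = fourier 0 := by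
    ext a; simp
  have h2 : (fun a : UnitAddCircle => (∑' t, h t * fourier t a) * 1) = fun _ => 0 := by
    ext a; rw [h0, zero_mul]
  rw [h2, hone] at this
  have h3 : fourierCoeff (fun _ : UnitAddCircle => (0 : ℂ)) m = 0 := by
    simp [fourierCoeff]
  rw [h3] at this
  have h4 : ∀ t, fourierCoeff (fourier 0 : UnitAddCircle → ℂ) (m - t) = if t = m then 1 else 0 := by
    intro t
    rw [fourierCoeff_fourier]
    simp only [Pi.single_apply, sub_eq_zero, eq_comm]
  simp_rw [h4] at this
  have h5 : HasSum (fun t => h t * if t = m then (1 : ℂ) else 0) (h m) := by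
    convert hasSum_ite_eq m (h m) using 2 with t
    split_ifs with ht <;> simp [ht]
  exact h5.unique this

lemma norm_gaussian_mul_zpow_le {c μ B ρ : ℝ} (hc : 0 < c) (hμ : 0 < μ) {v : ℤ → ℂ}
    (hv : ∀ m, ‖v m‖ ≤ B) {Y : ℂ} (hY : Y ≠ 0) (hρ : |Real.log ‖Y‖| ≤ ρ) (m : ℤ) :
    ‖v m * (Real.exp (-c * (m : ℝ) ^ 2) : ℂ) * Y ^ m‖ ≤
      B * (Real.exp (ρ ^ 2 / (4 * c * μ)) * Real.exp (-(c * (1 - μ)) * (m : ℝ) ^ 2)) := by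
  have hY' : 0 < ‖Y‖ := norm_pos_iff.2 hY
  have hB : 0 ≤ B := (norm_nonneg _).trans (hv 0)
  have hz : ‖Y ^ m‖ = Real.exp (m * Real.log ‖Y‖) := by
    rw [norm_zpow, mul_comm, Real.exp_mul, Real.exp_log hY', Real.rpow_intCast]
  rw [norm_mul, norm_mul, hz, Complex.norm_real, Real.norm_of_nonneg (Real.exp_pos _).le, mul_assoc,
    ← Real.exp_add, ← Real.exp_add]
  refine mul_le_mul (hv m) (Real.exp_le_exp.2 ?_) (Real.exp_pos _).le hB
  set l := Real.log ‖Y‖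
  have hl : l ^ 2 ≤ ρ ^ 2 := sq_le_sq' (by linarith [neg_abs_le l]) ((le_abs_self l).trans hρ)
  have h1 : l ^ 2 / (4 * c * μ) ≤ ρ ^ 2 / (4 * c * μ) := by gcongr
  have h2 : 0 ≤ (l - 2 * c * μ * m) ^ 2 / (4 * c * μ) := by positivity
  have h3 : (l - 2 * c * μ * m) ^ 2 / (4 * c * μ) = l ^ 2 / (4 * c * μ) - m * l + c * μ * m ^ 2 := by
    field_simp
    ring
  linarith

lemma differentiableOn_tsum_gaussian_mul_zpow {c B : ℝ} (hc : 0 < c) {v : ℤ → ℂ}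
    (hv : ∀ m, ‖v m‖ ≤ B) :
    DifferentiableOn ℂ (fun Y : ℂ => ∑' m : ℤ, v m * (Real.exp (-c * (m : ℝ) ^ 2) : ℂ) * Y ^ m)
      {0}ᶜ := by
  intro Y hY
  refine DifferentiableAt.differentiableWithinAt ?_
  have hY0 : Y ≠ 0 := hY
  have hcont : ContinuousAt (fun Z : ℂ => |Real.log ‖Z‖|) Y :=
    ((Real.continuousAt_log (norm_ne_zero_iff.2 hY0)).comp continuous_norm.continuousAt).abs
  have hmem : ∀ᶠ Z in 𝓝 Y, Z ≠ 0 ∧ |Real.log ‖Z‖| < |Real.log ‖Y‖| + 1 :=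
    (eventually_ne_nhds hY0).and (hcont.eventually_lt_const (by linarith))
  obtain ⟨U, hU, hUo, hYU⟩ := eventually_nhds_iff.1 hmem
  have hd : DifferentiableOn ℂ
      (fun Y : ℂ => ∑' m : ℤ, v m * (Real.exp (-c * (m : ℝ) ^ 2) : ℂ) * Y ^ m) U := by
    refine differentiableOn_tsum_of_summable_norm (u := fun m : ℤ => B * (Real.exp
      ((|Real.log ‖Y‖| + 1) ^ 2 / (4 * c * (1 / 2))) *
        Real.exp (-(c * (1 - 1 / 2)) * (m : ℝ) ^ 2))) ?_ ?_ hUo ?_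
    · exact ((summable_exp_neg_mul_int_sq (by linarith)).mul_left _).mul_left _
    · intro m Z hZ
      exact ((differentiableAt_zpow.2 (Or.inl (hU Z hZ).1)).const_mul _).differentiableWithinAt
    · intro m Z hZ
      exact norm_gaussian_mul_zpow_le hc (by norm_num) hv (hU Z hZ).1 (hU Z hZ).2.le m
  exact hd.differentiableAt (hUo.mem_nhds hYU)

lemma norm_tsum_gaussian_mul_zpow_le {c μ B ρ : ℝ} (hc : 0 < c) (hμ : 0 < μ) (hμ1 : μ < 1)
    {v : ℤ → ℂ} (hv : ∀ m, ‖v m‖ ≤ B) {Y : ℂ} (hY : Y ≠ 0) (hρ : |Real.log ‖Y‖| ≤ ρ) :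
    ‖∑' m : ℤ, v m * (Real.exp (-c * (m : ℝ) ^ 2) : ℂ) * Y ^ m‖ ≤
      B * (Real.exp (ρ ^ 2 / (4 * c * μ)) *
        ∑' m : ℤ, Real.exp (-(c * (1 - μ)) * (m : ℝ) ^ 2)) := by
  have hs : Summable fun m : ℤ => Real.exp (-(c * (1 - μ)) * (m : ℝ) ^ 2) :=
    summable_exp_neg_mul_int_sq (mul_pos hc (by linarith))
  refine tsum_of_norm_bounded (((hs.hasSum).mul_left _).mul_left _) fun m => ?_
  exact norm_gaussian_mul_zpow_le hc hμ hv hY hρ m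

/-- A function holomorphic on `ℂ \ {0}` which vanishes at `exp (L k)` for `|k| ≤ K` is small on the
unit circle, relatively to its size on the circles of radius `exp (± L (K + 1))`. -/
lemma norm_le_of_zeros_of_bound {f : ℂ → ℂ} (hf : DifferentiableOn ℂ f {0}ᶜ) {L : ℝ} (hL : 0 < L)
    (K : ℕ) (hz : ∀ k : ℤ, f (Real.exp (L * k)) = 0) {M : ℝ}
    (hM : ∀ Y : ℂ, Y ≠ 0 → |Real.log ‖Y‖| ≤ L * (K + 1) → ‖f Y‖ ≤ M) {Y : ℂ} (hY : ‖Y‖ = 1) :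
    ‖f Y‖ ≤ (2 / (1 - Real.exp (-L))) ^ (2 * K + 1) * M * Real.exp (-(L * (K * (K + 1) / 2))) := by
  have hM0 : 0 ≤ M := (norm_nonneg _).trans
    (hM 1 one_ne_zero (by simp; positivity))
  set J := Finset.Icc (-(K : ℤ)) K with hJ
  have hcard : J.card = 2 * K + 1 := by
    rw [hJ, Int.card_Icc]; omega
  set δ := 1 - Real.exp (-L) with hδ
  have hδ0 : 0 < δ := by
    rw [hδ, sub_pos, Real.exp_lt_one_iff]; linarith
  have hinj : Set.InjOn (fun k : ℤ => ((Real.exp (L * k) : ℝ) : ℂ)) J := by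
    intro k _ k' _ h
    have h1 : Real.exp (L * k) = Real.exp (L * k') := Complex.ofReal_injective h
    have h2 := mul_left_cancel₀ hL.ne' (Real.exp_injective h1)
    exact_mod_cast h2
  obtain ⟨h, hd, hfac⟩ := exists_eq_prod_sub_mul (isOpen_compl_singleton) hf
    (J.image fun k : ℤ => ((Real.exp (L * k) : ℝ) : ℂ)) (by
      intro s hs
      obtain ⟨k, -, rfl⟩ := Finset.mem_image.1 hs
      exact ⟨by simp, hz k⟩)
  simp_rw [Finset.prod_image hinj] at hfac
  set R := Real.exp (L * (K + 1)) with hR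
  have hR0 : 0 < R := Real.exp_pos _
  set U : Set ℂ := {Y | R⁻¹ < ‖Y‖ ∧ ‖Y‖ < R} with hU
  have hUo : IsOpen U := (isOpen_lt continuous_const continuous_norm).inter
    (isOpen_lt continuous_norm continuous_const)
  have hUc : closure U ⊆ {Y | R⁻¹ ≤ ‖Y‖ ∧ ‖Y‖ ≤ R} := closure_minimal
    (fun Y hY => ⟨hY.1.le, hY.2.le⟩) ((isClosed_le continuous_const continuous_norm).inter
      (isClosed_le continuous_norm continuous_const))
  have hUne : ∀ Y ∈ closure U, Y ≠ 0 := by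
    rintro Y hY rfl
    have := (hUc hY).1
    rw [norm_zero] at this
    exact absurd this (not_le.2 (inv_pos.2 hR0))
  have hfr : ∀ Y ∈ frontier U, ‖Y‖ = R ∨ ‖Y‖ = R⁻¹ := by
    intro Y hY
    rw [hUo.frontier_eq] at hY
    obtain ⟨h1, h2⟩ := hUc hY.1
    by_contra! hcon
    exact hY.2 ⟨lt_of_le_of_ne h1 hcon.2.symm, lt_of_le_of_ne h2 hcon.1⟩
  have hprod : ∀ Y : ℂ, ‖Y‖ = R ∨ ‖Y‖ = R⁻¹ →
      δ ^ (2 * K + 1) * Real.exp (L * (K * (K + 1))) * ‖Y ^ K‖ ≤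
        ‖∏ k ∈ J, (Y - ((Real.exp (L * k) : ℝ) : ℂ))‖ := by
    intro Y hY
    rw [norm_prod]
    rcases hY with hY | hY
    · have h1 : ∀ k ∈ J, δ * R ≤ ‖Y - ((Real.exp (L * k) : ℝ) : ℂ)‖ := by
        intro k hk
        have hk' : (k : ℝ) ≤ K := by exact_mod_cast (Finset.mem_Icc.1 hk).2
        have h2 := norm_sub_norm_le Y ((Real.exp (L * k) : ℝ) : ℂ)
        rw [hY, Complex.norm_real, Real.norm_of_nonneg (Real.exp_pos _).le] at h2
        have h3 : Real.exp (L * k) ≤ Real.exp (-L) * R := by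
          rw [hR, ← Real.exp_add]
          apply Real.exp_le_exp.2
          nlinarith
        rw [hδ]; linarith
      have h4 := Finset.prod_le_prod (fun k _ => (by positivity : 0 ≤ δ * R)) h1
      rw [Finset.prod_const, hcard, mul_pow] at h4
      refine le_trans ?_ h4
      rw [mul_assoc]
      refine mul_le_mul_of_nonneg_left ?_ (by positivity)
      rw [norm_pow, hY, hR, ← Real.exp_nat_mul, ← Real.exp_nat_mul, ← Real.exp_add]
      apply Real.exp_le_exp.2
      push_cast
      have : 0 ≤ L * (K + 1) := by positivity
      nlinarith
    · have h1 : ∀ k ∈ J, δ * Real.exp (L * k) ≤ ‖Y - ((Real.exp (L * k) : ℝ) : ℂ)‖ := by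
        intro k hk
        have hk' : -(K : ℝ) ≤ k := by exact_mod_cast (Finset.mem_Icc.1 hk).1
        have h2 := norm_sub_norm_le ((Real.exp (L * k) : ℝ) : ℂ) Y
        rw [hY, Complex.norm_real, Real.norm_of_nonneg (Real.exp_pos _).le, norm_sub_rev] at h2
        have h3 : R⁻¹ ≤ Real.exp (-L) * Real.exp (L * k) := by
          rw [hR, ← Real.exp_neg, ← Real.exp_add]
          apply Real.exp_le_exp.2
          nlinarith
        rw [hδ]; linarith
      have h4 := Finset.prod_le_prod
        (fun k _ => (mul_nonneg hδ0.le (Real.exp_pos _).le)) h1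
      rw [Finset.prod_mul_distrib, Finset.prod_const, hcard, prod_Icc_neg_exp, mul_one] at h4
      refine le_trans (le_of_eq ?_) h4
      rw [mul_assoc, norm_pow, hY, hR, ← Real.exp_neg, ← Real.exp_nat_mul, ← Real.exp_add]
      rw [show L * (K * (K + 1)) + K * -(L * (K + 1)) = (0 : ℝ) by ring, Real.exp_zero, mul_one]
  have hlogR : ∀ Y : ℂ, ‖Y‖ = R ∨ ‖Y‖ = R⁻¹ → |Real.log ‖Y‖| ≤ L * (K + 1) := by
    have h0 : 0 ≤ L * (K + 1) := by positivity
    rintro Y (hY | hY)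
    · rw [hY, hR, Real.log_exp, abs_of_nonneg h0]
    · rw [hY, hR, Real.log_inv, Real.log_exp, abs_neg, abs_of_nonneg h0]
  set T := δ ^ (2 * K + 1) * Real.exp (L * (K * (K + 1))) with hT
  have hT0 : 0 < T := by positivity
  have hmax : ‖h Y * Y ^ K‖ ≤ M / T := by
    refine Complex.norm_le_of_forall_mem_frontier_norm_le (U := U)
      (f := fun Y => h Y * Y ^ K) ?_ ?_ ?_ ?_
    · refine (Metric.isBounded_closedBall (x := (0 : ℂ)) (r := R)).subset fun Y hY => ?_
      simpa using hY.2.le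
    · refine DifferentiableOn.diffContOnCl ?_
      exact (hd.mono fun Y hY => hUne Y hY).mul (differentiable_id.pow K).differentiableOn
    · intro Z hZ
      have hZ0 : Z ≠ 0 := hUne Z (frontier_subset_closure hZ)
      have h1 := hM Z hZ0 (hlogR Z (hfr Z hZ))
      rw [hfac, norm_mul] at h1
      have h2 := hprod Z (hfr Z hZ)
      rw [le_div_iff₀ hT0, norm_mul]
      have h3 := mul_le_mul_of_nonneg_right h2 (norm_nonneg (h Z))
      nlinarith
    · refine subset_closure ?_
      have : 1 < R := by
        rw [hR, Real.one_lt_exp_iff]; positivity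
      simp only [hU, Set.mem_ofPred_eq, hY]
      exact ⟨inv_lt_one_of_one_lt₀ this, this⟩
  rw [norm_mul, norm_pow, hY, one_pow, mul_one] at hmax
  have hprod1 : ‖∏ k ∈ J, (Y - ((Real.exp (L * k) : ℝ) : ℂ))‖ ≤
      2 ^ (2 * K + 1) * Real.exp (L * (K * (K + 1) / 2)) := by
    rw [norm_prod, ← prod_Icc_neg_exp_max, ← hcard, ← Finset.prod_const, ← Finset.prod_mul_distrib]
    refine Finset.prod_le_prod (fun k _ => norm_nonneg _) fun k _ => ?_
    refine (norm_sub_le _ _).trans ?_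
    rw [hY, Complex.norm_real, Real.norm_of_nonneg (Real.exp_pos _).le]
    have h1 : 1 ≤ Real.exp (L * max (k : ℝ) 0) := Real.one_le_exp (by positivity)
    have h2 : Real.exp (L * k) ≤ Real.exp (L * max (k : ℝ) 0) :=
      Real.exp_le_exp.2 (mul_le_mul_of_nonneg_left (le_max_left _ _) hL.le)
    linarith
  rw [hfac, norm_mul]
  refine (mul_le_mul hprod1 hmax (norm_nonneg _) (by positivity)).trans (le_of_eq ?_)
  rw [hT, div_pow]
  have : Real.exp (L * (K * (K + 1))) =
      Real.exp (L * (K * (K + 1) / 2)) * Real.exp (L * (K * (K + 1) / 2)) := by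
    rw [← Real.exp_add]; congr 1; ring
  rw [this, Real.exp_neg]
  field_simp

/-- A bounded sequence `v` such that `∑ v m exp (-c m ^ 2) Y ^ m` vanishes on a geometric progression
which is denser than critical is zero. -/
theorem eq_zero_of_tsum_gaussian_eq_zero {c θ B : ℝ} (hc : 0 < c) (hθ : 0 < θ) (hθ1 : θ < 1)
    {v : ℤ → ℂ} (hv : ∀ m, ‖v m‖ ≤ B)
    (hz : ∀ k : ℤ, ∑' m : ℤ, v m * (Real.exp (-c * (m : ℝ) ^ 2) : ℂ) *
      ((Real.exp (2 * c * θ * k) : ℝ) : ℂ) ^ m = 0) (m : ℤ) : v m = 0 := by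
  set f : ℂ → ℂ := fun Y => ∑' m : ℤ, v m * (Real.exp (-c * (m : ℝ) ^ 2) : ℂ) * Y ^ m with hf
  set L := 2 * c * θ with hL
  have hL0 : 0 < L := by positivity
  set μ := (1 + θ) / 2 with hμ
  have hμ0 : 0 < μ := by rw [hμ]; linarith
  have hμ1 : μ < 1 := by rw [hμ]; linarith
  have hθμ : θ / μ < 1 := by rw [div_lt_one hμ0, hμ]; linarith
  set S := ∑' m : ℤ, Real.exp (-(c * (1 - μ)) * (m : ℝ) ^ 2) with hS
  set A := Real.log (2 / (1 - Real.exp (-L))) with hA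
  have hδ0 : 0 < 1 - Real.exp (-L) := by
    rw [sub_pos, Real.exp_lt_one_iff]; linarith
  have hA0 : 0 ≤ A := by
    apply Real.log_nonneg
    rw [le_div_iff₀ hδ0]
    linarith [Real.exp_pos (-L)]
  have hB : 0 ≤ B := (norm_nonneg _).trans (hv 0)
  have hS0 : 0 ≤ S := tsum_nonneg fun m => (Real.exp_pos _).le
  have hcirc : ∀ Y : ℂ, ‖Y‖ = 1 → f Y = 0 := by
    intro Y hY
    have hbound : ∀ K : ℕ, ‖f Y‖ ≤ B * S * Real.exp (((K : ℝ) + 1) *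
        (2 * A + L * (θ / μ) / 2 + -(L * (1 - θ / μ) / 2) * K)) := by
      intro K
      have h1 := norm_le_of_zeros_of_bound (differentiableOn_tsum_gaussian_mul_zpow hc hv) hL0 K hz
        (fun Z hZ hZ' => norm_tsum_gaussian_mul_zpow_le hc hμ0 hμ1 hv hZ hZ') hY
      refine h1.trans ?_
      rw [← Real.exp_log (div_pos two_pos hδ0), ← hA, ← Real.exp_nat_mul]
      have e : Real.exp (((2 * K + 1 : ℕ) : ℝ) * A) * (B * (Real.exp ((L * (K + 1)) ^ 2 /
          (4 * c * μ)) * S)) * Real.exp (-(L * (K * (K + 1) / 2))) = B * S * Real.exp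
          (((2 * K + 1 : ℕ) : ℝ) * A + (L * (K + 1)) ^ 2 / (4 * c * μ) +
            -(L * (K * (K + 1) / 2))) := by
        rw [Real.exp_add, Real.exp_add]; ring
      rw [e]
      refine mul_le_mul_of_nonneg_left (Real.exp_le_exp.2 ?_) (by positivity)
      have e2 : (L * ((K : ℝ) + 1)) ^ 2 / (4 * c * μ) = L * (θ / μ) / 2 * (K + 1) ^ 2 := by
        rw [hL]; field_simp; ring
      rw [e2]
      push_cast
      nlinarith
    have hlim : Tendsto (fun K : ℕ => B * S * Real.exp (((K : ℝ) + 1) *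
        (2 * A + L * (θ / μ) / 2 + -(L * (1 - θ / μ) / 2) * K))) atTop (𝓝 (B * S * 0)) := by
      refine Tendsto.const_mul _ (Real.tendsto_exp_atBot.comp ?_)
      refine Tendsto.atTop_mul_atBot₀
        (tendsto_atTop_add_const_right _ _ tendsto_natCast_atTop_atTop) ?_
      refine tendsto_atBot_add_const_left _ _ ?_
      refine Tendsto.const_mul_atTop_of_neg ?_ tendsto_natCast_atTop_atTop
      have : 0 < L * (1 - θ / μ) := mul_pos hL0 (by linarith)
      linarith
    rw [mul_zero] at hlim
    exact norm_le_zero_iff.1 (ge_of_tendsto' hlim hbound)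
  have hsum : Summable fun m : ℤ => v m * (Real.exp (-c * (m : ℝ) ^ 2) : ℂ) := by
    refine Summable.of_norm_bounded ((summable_exp_neg_mul_int_sq hc).mul_left B) fun m => ?_
    rw [norm_mul, Complex.norm_real, Real.norm_of_nonneg (Real.exp_pos _).le]
    exact mul_le_mul_of_nonneg_right (hv m) (Real.exp_pos _).le
  have h0 := eq_zero_of_tsum_fourier_eq_zero hsum (fun a => by
    have := hcirc (fourier 1 a) (by rw [fourier_apply, Circle.norm_coe])
    rw [← this, hf]
    refine tsum_congr fun m => ?_
    rw [fourier_apply, fourier_apply, one_zsmul, AddCircle.toCircle_zsmul, Circle.coe_zpow]) m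
  exact (mul_eq_zero.1 h0).resolve_right (by exact_mod_cast (Real.exp_pos _).ne')

lemma hasSum_int_divMod {p : ℕ} [NeZero p] {F : ℤ → ℂ} (hF : Summable F) :
    HasSum F (∑ u : Fin p, ∑' t : ℤ, F (t * p + (u : ℕ))) := by
  have h1 : Summable (F ∘ (Int.divModEquiv p).symm) := (Int.divModEquiv p).symm.summable_iff.2 hF
  have h2 := ((Equiv.prodComm (Fin p) ℤ).summable_iff.2 h1).hasSum
  have h3 := (Equiv.prodComm (Fin p) ℤ).hasSum_iff.1 h2
  have h4 := (Int.divModEquiv p).symm.hasSum_iff.1 h3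
  have h5 := (((Equiv.prodComm (Fin p) ℤ).summable_iff.2 h1).tsum_prod)
  rw [h5, tsum_fintype] at h4
  exact h4

lemma exists_det_ne_zero_of_injective {ι : Type*} {p : ℕ} {N : ι → Fin p → ℂ}
    (hN : ∀ v : Fin p → ℂ, (∀ k, ∑ u, v u * N k u = 0) → v = 0) :
    ∃ k : Fin p → ι, (Matrix.of fun i u => N (k i) u).det ≠ 0 := by
  have htop : Submodule.span ℂ (Set.range N) = ⊤ := by
    by_contra hne
    obtain ⟨f, hf0, hf⟩ := Submodule.exists_le_ker_of_lt_top _ (lt_top_iff_ne_top.2 hne)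
    have hv := hN (fun u => f fun j => if u = j then 1 else 0) fun k => by
      have h1 : f (N k) = 0 := hf (Submodule.subset_span ⟨k, rfl⟩)
      rw [LinearMap.pi_apply_eq_sum_univ f] at h1
      refine Eq.trans ?_ h1
      exact Finset.sum_congr rfl fun u _ => mul_comm _ _
    refine hf0 (LinearMap.ext fun x => ?_)
    rw [LinearMap.pi_apply_eq_sum_univ f, LinearMap.zero_apply]
    refine Finset.sum_eq_zero fun u _ => ?_
    have := congrFun hv u
    simp only [Pi.zero_apply] at this
    rw [this, smul_zero]
  have hrank : Module.finrank ℂ (Submodule.span ℂ (Set.range N)) = p := by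
    rw [htop, finrank_top, Module.finrank_fin_fun]
  obtain ⟨f, hf, -, hli⟩ := Submodule.exists_fun_fin_finrank_span_eq ℂ (Set.range N)
  have hli' := hli.comp (Fin.cast hrank.symm) (Fin.cast_injective _)
  choose k hk using hf
  refine ⟨fun i => k (Fin.cast hrank.symm i), ?_⟩
  rw [← isUnit_iff_ne_zero, ← Matrix.isUnit_iff_isUnit_det, ← Matrix.linearIndependent_rows_iff_isUnit]
  have hrow : (Matrix.of fun i u => N (k (Fin.cast hrank.symm i)) u).row =
      f ∘ Fin.cast hrank.symm := by
    ext i u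
    simp [Matrix.row, hk]
  rw [hrow]
  exact hli'

/-- The set of real zeros of a nonzero entire function is countable. -/
lemma countable_real_zeros {f : ℂ → ℂ} (hf : Differentiable ℂ f) {z₀ : ℂ} (h0 : f z₀ ≠ 0) :
    {x : ℝ | f x = 0}.Countable := by
  have h1 := (hf.differentiableOn.analyticOnNhd isOpen_univ).preimage_zero_mem_codiscrete h0
  have h2 : {z : ℂ | f z = 0}.Countable := by
    have h3 : (f ⁻¹' {0}ᶜ)ᶜ = {z : ℂ | f z = 0} := by
      ext z; simp
    have h1 := mem_codiscrete'.1 h1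
    rw [h3] at h1
    have hd : DiscreteTopology {z : ℂ | f z = 0} := isDiscrete_iff_discreteTopology.1 h1.2
    exact countable_of_Lindelof_of_discrete
  exact h2.preimage Complex.ofReal_injective

/-- A complex-scaled theta series: the discrete transform, along `p ℤ`, of `exp (-c y ^ 2 + l y)`. -/
lemma hasSum_gaussian_theta {c : ℝ} (hc : 0 < c) (p : ℕ) [NeZero p] (l y ζ : ℂ) :
    HasSum (fun t : ℤ => Complex.exp (-c * (y + t * p) ^ 2 + l * (y + t * p)) *
        Complex.exp (2 * π * I * t * ζ))
      (Complex.exp (-c * y ^ 2 + l * y) *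
        jacobiTheta₂ (ζ + p * (l - 2 * c * y) / (2 * π * I)) (I * (c * p ^ 2 / π : ℝ))) := by
  have hp : 0 < p := Nat.pos_of_ne_zero (NeZero.ne p)
  have hpi : (π : ℂ) ≠ 0 := by exact_mod_cast Real.pi_ne_zero
  have him : 0 < ((I * (c * p ^ 2 / π : ℝ) : ℂ)).im := by
    rw [Complex.I_mul_im, Complex.ofReal_re]
    have := Real.pi_pos
    positivity
  have h := (hasSum_jacobiTheta₂_term (ζ + p * (l - 2 * c * y) / (2 * π * I)) him).mul_left
    (Complex.exp (-c * y ^ 2 + l * y))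
  refine h.congr_fun fun t => ?_
  rw [jacobiTheta₂_term, ← Complex.exp_add, ← Complex.exp_add]
  congr 1
  push_cast
  field_simp
  ring_nf
  simp only [I_sq]
  ring

/-- A Gaussian times an exponential polynomial with frequencies in `Λ`. -/
noncomputable def gaussExp (c : ℝ) (Λ : Finset ℂ) (κ : ℂ → ℂ) (y : ℂ) : ℂ :=
  ∑ l ∈ Λ, κ l * Complex.exp (-c * y ^ 2 + l * y)

/-- The Zak transform entries of the Gabor system generated by `gaussExp`. -/
noncomputable def zakEntry (c θ : ℝ) (Λ : Finset ℂ) (κ : ℂ → ℂ) (p : ℕ) (x ζ : ℂ) (k : ℤ)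
    (u : Fin p) : ℂ :=
  ∑' t : ℤ, gaussExp c Λ κ (x + u - θ * k + t * p) * Complex.exp (2 * π * I * t * ζ)

lemma hasSum_zakEntry {c : ℝ} (hc : 0 < c) (θ : ℝ) (Λ : Finset ℂ) (κ : ℂ → ℂ) {p : ℕ} [NeZero p]
    (x ζ : ℂ) (k : ℤ) (u : Fin p) :
    HasSum (fun t : ℤ => gaussExp c Λ κ (x + u - θ * k + t * p) * Complex.exp (2 * π * I * t * ζ))
      (∑ l ∈ Λ, κ l * (Complex.exp (-c * (x + u - θ * k) ^ 2 + l * (x + u - θ * k)) *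
        jacobiTheta₂ (ζ + p * (l - 2 * c * (x + u - θ * k)) / (2 * π * I))
          (I * (c * p ^ 2 / π : ℝ)))) := by
  have h := hasSum_sum (s := Λ) fun l _ =>
    (hasSum_gaussian_theta hc p l (x + u - θ * k) ζ).mul_left (κ l)
  refine h.congr_fun fun t => ?_
  rw [gaussExp, Finset.sum_mul]
  exact Finset.sum_congr rfl fun l _ => by ring

lemma differentiable_zakEntry {c : ℝ} (hc : 0 < c) (θ : ℝ) (Λ : Finset ℂ) (κ : ℂ → ℂ) {p : ℕ}
    [NeZero p] {x ζ : ℂ → ℂ} (hx : Differentiable ℂ x) (hζ : Differentiable ℂ ζ) (k : ℤ)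
    (u : Fin p) : Differentiable ℂ fun z => zakEntry c θ Λ κ p (x z) (ζ z) k u := by
  have hp : 0 < p := Nat.pos_of_ne_zero (NeZero.ne p)
  have him : 0 < ((I * (c * p ^ 2 / π : ℝ) : ℂ)).im := by
    rw [Complex.I_mul_im, Complex.ofReal_re]
    have := Real.pi_pos
    positivity
  have hj : Differentiable ℂ fun z => jacobiTheta₂ z (I * (c * p ^ 2 / π : ℝ)) :=
    fun z => differentiableAt_jacobiTheta₂_fst z him
  have e : (fun z => zakEntry c θ Λ κ p (x z) (ζ z) k u) = fun z =>
      ∑ l ∈ Λ, κ l * (Complex.exp (-c * (x z + u - θ * k) ^ 2 + l * (x z + u - θ * k)) *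
        jacobiTheta₂ (ζ z + p * (l - 2 * c * (x z + u - θ * k)) / (2 * π * I))
          (I * (c * p ^ 2 / π : ℝ))) :=
    funext fun z => (hasSum_zakEntry hc θ Λ κ (x z) (ζ z) k u).tsum_eq
  rw [e]
  refine Differentiable.fun_sum fun l _ => ?_
  have h2 : Differentiable ℂ fun z =>
      jacobiTheta₂ (ζ z + p * (l - 2 * c * (x z + u - θ * k)) / (2 * π * I))
        (I * (c * p ^ 2 / π : ℝ)) := hj.comp (by fun_prop)
  fun_prop

lemma differentiable_det_zakEntry {c : ℝ} (hc : 0 < c) (θ : ℝ) (Λ : Finset ℂ) (κ : ℂ → ℂ) {p : ℕ}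
    [NeZero p] {x ζ : ℂ → ℂ} (hx : Differentiable ℂ x) (hζ : Differentiable ℂ ζ)
    (k : Fin p → ℤ) :
    Differentiable ℂ fun z =>
      (Matrix.of fun i u => zakEntry c θ Λ κ p (x z) (ζ z) (k i) u).det := by
  simp_rw [Matrix.det_apply]
  refine Differentiable.fun_sum fun σ _ => Differentiable.const_smul ?_ _
  refine Differentiable.fun_finsetProd fun i _ => ?_
  exact differentiable_zakEntry hc θ Λ κ hx hζ _ _

/-- The columns of the Zak matrix of a single Gaussian are linearly independent. -/
lemma eq_zero_of_gaussian_rows {c θ : ℝ} (hc : 0 < c) (hθ : 0 < θ) {p : ℕ} [NeZero p]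
    (h : θ < 1 ∨ p = 1) {v : Fin p → ℂ}
    (hv : ∀ k : ℤ, ∑ u, v u *
      ∑' t : ℤ, Complex.exp (-c * ((u : ℂ) - θ * k + t * p) ^ 2) = 0) : v = 0 := by
  have hp : 0 < p := Nat.pos_of_ne_zero (NeZero.ne p)
  rcases h with hθ1 | rfl
  · set w : ℤ → ℂ := fun m => v (Int.divModEquiv p m).2 with hw
    have hwb : ∀ m, ‖w m‖ ≤ ∑ u, ‖v u‖ := fun m =>
      Finset.single_le_sum (f := fun u => ‖v u‖) (fun u _ => norm_nonneg _) (Finset.mem_univ _)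
    have hwu : ∀ (t : ℤ) (u : Fin p), w (t * p + (u : ℕ)) = v u := by
      intro t u
      have := (Int.divModEquiv p).apply_symm_apply (t, u)
      rw [Int.divModEquiv_symm_apply] at this
      simp only [hw]
      rw [this]
    have hw0 := eq_zero_of_tsum_gaussian_eq_zero hc hθ hθ1 hwb fun k => by
      have hsum : Summable fun m : ℤ => w m * (Real.exp (-c * (m : ℝ) ^ 2) : ℂ) *
          ((Real.exp (2 * c * θ * k) : ℝ) : ℂ) ^ m := by
        refine Summable.of_norm_bounded ?_ (fun m => norm_gaussian_mul_zpow_le hc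
          (by norm_num : (0 : ℝ) < 1 / 2) hwb (by simp) le_rfl m)
        exact ((summable_exp_neg_mul_int_sq (by linarith)).mul_left _).mul_left _
      rw [(hasSum_int_divMod (p := p) hsum).tsum_eq]
      have e : ∀ (u : Fin p) (t : ℤ), w (t * p + (u : ℕ)) *
          (Real.exp (-c * ((t * p + (u : ℕ) : ℤ) : ℝ) ^ 2) : ℂ) *
          ((Real.exp (2 * c * θ * k) : ℝ) : ℂ) ^ (t * p + (u : ℕ) : ℤ) =
          Complex.exp (c * (θ * k) ^ 2) *
            (v u * Complex.exp (-c * ((u : ℂ) - θ * k + t * p) ^ 2)) := by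
        intro u t
        rw [hwu, Complex.ofReal_exp, Complex.ofReal_exp, ← Complex.exp_int_mul, mul_assoc,
          ← Complex.exp_add, mul_left_comm, ← Complex.exp_add]
        congr 2
        push_cast
        ring
      simp_rw [e, tsum_mul_left, ← Finset.mul_sum, hv k, mul_zero]
    ext u
    have := hw0 (0 * p + (u : ℕ))
    rwa [hwu] at this
  · have h0 := hv 0
    rw [Fin.sum_univ_one] at h0
    have hpos : 0 < ∑' t : ℤ, Real.exp (-c * (t : ℝ) ^ 2) :=
      (summable_exp_neg_mul_int_sq hc).tsum_pos (fun t => (Real.exp_pos _).le) 0 (Real.exp_pos _)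
    have e : ∑' t : ℤ, Complex.exp (-c * (((0 : Fin 1) : ℕ) - θ * (0 : ℤ) + t * (1 : ℕ)) ^ 2) =
        ((∑' t : ℤ, Real.exp (-c * (t : ℝ) ^ 2) : ℝ) : ℂ) := by
      rw [Complex.ofReal_tsum]
      refine tsum_congr fun t => ?_
      push_cast
      congr 1
      simp
    rw [e] at h0
    have h1 := (mul_eq_zero.1 h0).resolve_right (by exact_mod_cast hpos.ne')
    ext u
    rw [Subsingleton.elim u 0, h1, Pi.zero_apply]

lemma exists_dominant_frequency {Λ : Finset ℂ} (hΛ : Λ.Nonempty) :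
    ∃ l₀ ∈ Λ, ∀ l ∈ Λ, l ≠ l₀ → ((l - l₀) * (starRingEnd ℂ) l₀).re < 0 := by
  obtain ⟨l₀, h₀, hmax⟩ := Λ.exists_max_image (fun l => ‖l‖) hΛ
  refine ⟨l₀, h₀, fun l hl hne => ?_⟩
  have h1 : Complex.normSq l ≤ Complex.normSq l₀ := by
    rw [Complex.normSq_eq_norm_sq, Complex.normSq_eq_norm_sq]
    exact pow_le_pow_left₀ (norm_nonneg _) (hmax l hl) 2
  have h2 : 0 < Complex.normSq (l - l₀) := Complex.normSq_pos.2 (sub_ne_zero.2 hne)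
  simp only [Complex.normSq_apply, sub_re, sub_im, mul_re, conj_re, conj_im] at *
  nlinarith

/-- Some maximal minor of the Zak matrix is not identically zero. -/
theorem exists_det_zakEntry_ne_zero {c θ : ℝ} (hc : 0 < c) (hθ : 0 < θ) {p : ℕ} [NeZero p]
    (h : θ < 1 ∨ p = 1) {Λ : Finset ℂ} (hΛ : Λ.Nonempty) {κ : ℂ → ℂ} (hκ : ∀ l ∈ Λ, κ l ≠ 0) :
    ∃ (k : Fin p → ℤ) (x ζ : ℂ),
      (Matrix.of fun i u => zakEntry c θ Λ κ p x ζ (k i) u).det ≠ 0 := by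
  have hpi : (π : ℂ) ≠ 0 := by exact_mod_cast Real.pi_ne_zero
  obtain ⟨k, hk⟩ := exists_det_ne_zero_of_injective
    (fun v hv => eq_zero_of_gaussian_rows (v := v) hc hθ h hv)
  obtain ⟨l₀, hl₀, hdom⟩ := exists_dominant_frequency hΛ
  set N : ℂ → Fin p → Fin p → ℂ := fun l i u => ∑' t : ℤ, Complex.exp
    (-c * ((u : ℂ) - θ * (k i : ℤ) + t * p) ^ 2 + (l - l₀) * ((u : ℂ) - θ * (k i : ℤ) + t * p))
    with hN
  set E : ℝ → Matrix (Fin p) (Fin p) ℂ := fun ρ => Matrix.of fun i u =>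
    ∑ l ∈ Λ, κ l * Complex.exp ((l - l₀) * (starRingEnd ℂ) l₀ * ρ) * N l i u with hE
  have hN0 : (Matrix.of (N l₀)).det ≠ 0 := by
    have : Matrix.of (N l₀) = Matrix.of fun i (u : Fin p) => ∑' t : ℤ, Complex.exp
        (-c * ((u : ℂ) - θ * (k i : ℤ) + t * p) ^ 2) := by
      ext i u
      simp [hN]
    rw [this]
    exact hk
  have hlim : Tendsto (fun ρ => (E ρ).det) atTop (𝓝 (κ l₀ • Matrix.of (N l₀)).det) := by
    have hdet : Continuous fun A : Matrix (Fin p) (Fin p) ℂ => A.det :=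
      continuous_id.matrix_det
    refine (hdet.tendsto _).comp ?_
    refine tendsto_pi_nhds.2 fun i => tendsto_pi_nhds.2 fun u => ?_
    have hz : ∀ l ∈ Λ, Tendsto (fun ρ : ℝ => κ l * Complex.exp
        ((l - l₀) * (starRingEnd ℂ) l₀ * ρ) * N l i u) atTop
        (𝓝 (if l = l₀ then κ l₀ * N l₀ i u else 0)) := by
      intro l hl
      split_ifs with hll
      · subst hll
        simp
      · have h1 : Tendsto (fun ρ : ℝ => Complex.exp ((l - l₀) * (starRingEnd ℂ) l₀ * ρ)) atTop
            (𝓝 0) := by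
          rw [tendsto_zero_iff_norm_tendsto_zero]
          simp_rw [Complex.norm_exp, Complex.re_mul_ofReal]
          exact Real.tendsto_exp_atBot.comp
            (Tendsto.const_mul_atTop_of_neg (hdom l hl hll) tendsto_id)
        have h2 := (h1.const_mul (κ l)).mul_const (N l i u)
        simpa using h2
    have := tendsto_finsetSum Λ hz
    rw [Finset.sum_ite_eq' Λ l₀, if_pos hl₀] at this
    exact this
  have hne : (κ l₀ • Matrix.of (N l₀)).det ≠ 0 := by
    rw [Matrix.det_smul]
    exact mul_ne_zero (pow_ne_zero _ (hκ l₀ hl₀)) hN0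
  obtain ⟨ρ, hρ⟩ := (hlim.eventually_ne hne).exists
  obtain ⟨s, hs⟩ : ∃ s : ℂ, s = (starRingEnd ℂ) l₀ * ρ := ⟨_, rfl⟩
  refine ⟨k, s, (2 * c * s - l₀) * p / (2 * π * I), ?_⟩
  have hfac : (Matrix.of fun i u => zakEntry c θ Λ κ p s
      ((2 * c * s - l₀) * p / (2 * π * I)) (k i) u) =
      Matrix.of fun i (u : Fin p) => Complex.exp (-(2 * c * s - l₀) * u) *
        (Matrix.of fun i (u : Fin p) => Complex.exp (-c * s ^ 2 + (2 * c * s - l₀) * (θ * (k i : ℤ)) +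
          l₀ * s) * E ρ i u) i u := by
    ext i u
    simp only [Matrix.of_apply, hE, zakEntry]
    rw [← mul_assoc (Complex.exp _), ← Complex.exp_add, Finset.mul_sum]
    have hterm : ∀ l ∈ Λ, HasSum (fun t : ℤ => κ l * (Complex.exp
        (-c * (s + u - θ * (k i : ℤ) + t * p) ^ 2 + l * (s + u - θ * (k i : ℤ) + t * p)) *
        Complex.exp (2 * π * I * t * ((2 * c * s - l₀) * p / (2 * π * I)))))
        (Complex.exp (-(2 * c * s - l₀) * u + (-c * s ^ 2 + (2 * c * s - l₀) * (θ * (k i : ℤ)) +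
          l₀ * s)) * (κ l * Complex.exp ((l - l₀) * (starRingEnd ℂ) l₀ * ρ) * N l i u)) := by
      intro l _
      have h1 := (hasSum_gaussian_theta hc p l (s + u - θ * (k i : ℤ))
        ((2 * c * s - l₀) * p / (2 * π * I))).summable.mul_left (κ l)
      have e : ∀ t : ℤ, κ l * (Complex.exp
        (-c * (s + u - θ * (k i : ℤ) + t * p) ^ 2 + l * (s + u - θ * (k i : ℤ) + t * p)) *
        Complex.exp (2 * π * I * t * ((2 * c * s - l₀) * p / (2 * π * I)))) =
        (Complex.exp (-(2 * c * s - l₀) * u + (-c * s ^ 2 + (2 * c * s - l₀) * (θ * (k i : ℤ)) +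
          l₀ * s)) * (κ l * Complex.exp ((l - l₀) * (starRingEnd ℂ) l₀ * ρ))) * Complex.exp
          (-c * ((u : ℂ) - θ * (k i : ℤ) + t * p) ^ 2 +
            (l - l₀) * ((u : ℂ) - θ * (k i : ℤ) + t * p)) := by
        intro t
        rw [← Complex.exp_add]
        rw [mul_left_comm (Complex.exp _) (κ l), mul_assoc (κ l), ← Complex.exp_add,
          ← Complex.exp_add]
        congr 2
        have e1 : 2 * π * I * t * ((2 * c * s - l₀) * p / (2 * π * I)) =
          t * ((2 * c * s - l₀) * p) := by field_simp
        have e2 : (l - l₀) * (starRingEnd ℂ) l₀ * ρ = (l - l₀) * s := by rw [hs]; ring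
        rw [e1, e2]
        ring
      refine h1.hasSum_iff.2 ?_
      rw [tsum_congr e, tsum_mul_left]
      ring
    rw [← (hasSum_sum hterm).tsum_eq]
    refine tsum_congr fun t => ?_
    rw [gaussExp, Finset.sum_mul]
    exact Finset.sum_congr rfl fun l _ => by ring
  rw [hfac, Matrix.det_mul_row, Matrix.det_mul_column]
  exact mul_ne_zero (Finset.prod_ne_zero_iff.2 fun _ _ => Complex.exp_ne_zero _)
    (mul_ne_zero (Finset.prod_ne_zero_iff.2 fun _ _ => Complex.exp_ne_zero _) hρ)

lemma exists_countable_det_zakEntry {c θ : ℝ} (hc : 0 < c) (hθ : 0 < θ) {p : ℕ} [NeZero p]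
    (h : θ < 1 ∨ p = 1) {Λ : Finset ℂ} (hΛ : Λ.Nonempty) {κ : ℂ → ℂ} (hκ : ∀ l ∈ Λ, κ l ≠ 0) :
    ∃ (k : Fin p → ℤ) (S : Set ℝ), S.Countable ∧ ∀ x : ℝ, x ∉ S →
      {ζ : ℝ | (Matrix.of fun i u => zakEntry c θ Λ κ p x ζ (k i) u).det = 0}.Countable := by
  obtain ⟨k, x₀, ζ₀, h0⟩ := exists_det_zakEntry_ne_zero hc hθ h hΛ hκ
  refine ⟨k, _, countable_real_zeros (z₀ := x₀) (differentiable_det_zakEntry hc θ Λ κ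
    differentiable_id (differentiable_const ζ₀) k) h0, fun x hx => ?_⟩
  exact countable_real_zeros (z₀ := ζ₀) (differentiable_det_zakEntry hc θ Λ κ
    (differentiable_const (x : ℂ)) differentiable_id k) hx

/-- An integrable function on the circle with vanishing Fourier coefficients vanishes. -/
theorem ae_eq_zero_of_fourierCoeff_eq_zero {P : UnitAddCircle → ℂ}
    (hP : Integrable P AddCircle.haarAddCircle) (h : ∀ n, fourierCoeff P n = 0) :
    P =ᵐ[AddCircle.haarAddCircle] 0 := by
  have hint : ∀ φ : C(UnitAddCircle, ℂ),
      Integrable (fun t => φ t * P t) AddCircle.haarAddCircle := fun φ =>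
    hP.bdd_mul (c := ‖φ‖) (map_continuous φ).aestronglyMeasurable
      (ae_of_all _ fun t => φ.norm_coe_le_norm t)
  let L : C(UnitAddCircle, ℂ) →ₗ[ℂ] ℂ :=
    { toFun := fun φ => ∫ t, φ t * P t ∂AddCircle.haarAddCircle
      map_add' := fun φ ψ => by
        simp only [ContinuousMap.add_apply, add_mul]
        exact integral_add (hint φ) (hint ψ)
      map_smul' := fun r φ => by
        simp only [ContinuousMap.smul_apply, smul_eq_mul, mul_assoc, RingHom.id_apply]
        exact integral_const_mul _ _ }
  have hLc : Continuous L := by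
    refine (L.mkContinuous (∫ t, ‖P t‖ ∂AddCircle.haarAddCircle) fun φ => ?_).continuous
    refine (norm_integral_le_integral_norm _).trans ?_
    rw [mul_comm, ← integral_const_mul]
    refine integral_mono (hint φ).norm (hP.norm.const_mul _) fun t => ?_
    rw [norm_mul]
    exact mul_le_mul_of_nonneg_right (φ.norm_coe_le_norm t) (norm_nonneg _)
  have hL : ∀ φ, L φ = 0 := by
    have hle : (Submodule.span ℂ (Set.range (@fourier 1))).topologicalClosure ≤ L.ker := by
      refine Submodule.topologicalClosure_minimal _ (Submodule.span_le.2 ?_)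
        (isClosed_singleton.preimage hLc)
      rintro _ ⟨n, rfl⟩
      have := h (-n)
      rw [fourierCoeff, neg_neg] at this
      exact this
    rw [span_fourier_closure_eq_top] at hle
    exact fun φ => hle (Submodule.mem_top : φ ∈ ⊤)
  refine ae_eq_zero_of_forall_setIntegral_isClosed_eq_zero hP fun s hs => ?_
  have hδ : ∀ n : ℕ, 0 < 1 / ((n : ℝ) + 1) := fun n => by positivity
  have hpt := thickenedIndicator_tendsto_indicator_closure hδ
    tendsto_one_div_add_atTop_nhds_zero_nat s
  rw [hs.closure_eq, tendsto_pi_nhds] at hpt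
  have hzero : ∀ n : ℕ, ∫ t, ((thickenedIndicator (hδ n) s t : ℝ) : ℂ) * P t
      ∂AddCircle.haarAddCircle = 0 := fun n =>
    hL ⟨fun t => ((thickenedIndicator (hδ n) s t : ℝ) : ℂ), by fun_prop⟩
  have hlim : Tendsto (fun n : ℕ => ∫ t, ((thickenedIndicator (hδ n) s t : ℝ) : ℂ) * P t
      ∂AddCircle.haarAddCircle) atTop (𝓝 (∫ t, s.indicator P t ∂AddCircle.haarAddCircle)) := by
    refine tendsto_integral_of_dominated_convergence (fun t => ‖P t‖) (fun n => ?_) hP.norm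
      (fun n => ae_of_all _ fun t => ?_) (ae_of_all _ fun t => ?_)
    · refine AEStronglyMeasurable.mul (Continuous.aestronglyMeasurable ?_) hP.1
      fun_prop
    · rw [norm_mul]
      refine mul_le_of_le_one_left (norm_nonneg _) ?_
      rw [Complex.norm_real, NNReal.norm_eq]
      exact_mod_cast thickenedIndicator_le_one (hδ n) s t
    · have h1 : Tendsto (fun n : ℕ => ((thickenedIndicator (hδ n) s t : ℝ) : ℂ) * P t) atTop
          (𝓝 ((((s.indicator (fun _ => (1 : NNReal)) t : NNReal) : ℝ) : ℂ) * P t)) :=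
        (((Complex.continuous_ofReal.comp NNReal.continuous_coe).tendsto _).comp
          (hpt t)).mul_const _
      convert h1 using 2
      by_cases ht : t ∈ s <;> simp [ht]
  rw [← integral_indicator hs.measurableSet]
  simp_rw [hzero] at hlim
  exact tendsto_nhds_unique hlim tendsto_const_nhds

lemma ae_haarAddCircle_notMem_of_countable {S : Set ℝ} (hS : S.Countable) :
    ∀ᵐ a : UnitAddCircle ∂AddCircle.haarAddCircle, ∀ ζ : ℝ, (ζ : UnitAddCircle) = a → ζ ∉ S := by
  have hnt : Nontrivial UnitAddCircle := by
    refine ⟨((1 / 2 : ℝ) : UnitAddCircle), 0, fun h => ?_⟩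
    obtain ⟨n, hn⟩ := (AddCircle.coe_eq_zero_iff 1).1 h
    rw [zsmul_one] at hn
    have h2 : ((2 * n : ℤ) : ℝ) = (1 : ℤ) := by push_cast; linarith
    have h3 : 2 * n = 1 := by exact_mod_cast h2
    omega
  have : ((fun ζ : ℝ => (ζ : UnitAddCircle)) '' S).Countable := hS.image _
  filter_upwards [this.ae_notMem AddCircle.haarAddCircle] with a ha ζ hζ hmem
  exact ha ⟨ζ, hmem, hζ⟩

lemma exists_fourierCoeff_eq {e : ℤ → ℂ} (he : Summable fun n => ‖e n‖ ^ 2) :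
    ∃ f : UnitAddCircle → ℂ, Integrable f AddCircle.haarAddCircle ∧ ∀ n, fourierCoeff f n = e n := by
  have hm : Memℓp e 2 := memℓp_gen (by simpa using he)
  refine ⟨(fourierBasis (T := 1)).repr.symm ⟨e, hm⟩,
    (Lp.memLp _).integrable (by norm_num), fun n => ?_⟩
  rw [← fourierBasis_repr, LinearIsometryEquiv.apply_symm_apply]

lemma summable_gaussExp {c : ℝ} (hc : 0 < c) (Λ : Finset ℂ) (κ : ℂ → ℂ) (p : ℕ) [NeZero p] (y : ℂ) :
    Summable fun t : ℤ => gaussExp c Λ κ (y + t * p) := by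
  have := (hasSum_zakEntry hc 0 Λ κ y 0 0 (0 : Fin p)).summable
  simpa using this

/-- A square-summable sequence orthogonal to all the sampled translates of `gaussExp` vanishes as
soon as one minor of the Zak matrix is almost nowhere zero. -/
theorem eq_zero_of_hasSum_mul_gaussExp {c θ : ℝ} (hc : 0 < c) {Λ : Finset ℂ} {κ : ℂ → ℂ} {p q : ℕ}
    [NeZero p] (hq : θ * q = p) {k : Fin p → ℤ} {x : ℝ}
    (hx : {ζ : ℝ | (Matrix.of fun i u => zakEntry c θ Λ κ p x ζ (k i) u).det = 0}.Countable)
    {C : ℤ → ℂ} (hC : Summable fun m => ‖C m‖ ^ 2)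
    (hs : ∀ k : ℤ, HasSum (fun m : ℤ => C m * gaussExp c Λ κ (x + m - θ * k)) 0) (m : ℤ) :
    C m = 0 := by
  have hp : (p : ℤ) ≠ 0 := by exact_mod_cast NeZero.ne p
  have hqc : (θ : ℂ) * q = p := by exact_mod_cast hq
  have hex : ∀ u : Fin p, ∃ f : UnitAddCircle → ℂ, Integrable f AddCircle.haarAddCircle ∧
      ∀ n, fourierCoeff f n = C ((u : ℕ) - n * p) := fun u =>
    exists_fourierCoeff_eq (e := fun n => C ((u : ℕ) - n * p)) <|
      hC.comp_injective (i := fun n : ℤ => ((u : ℕ) : ℤ) - n * p) fun a b hab =>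
        mul_right_cancel₀ hp (sub_right_injective hab)
  choose f hfi hfc using hex
  set h : Fin p → Fin p → ℤ → ℂ := fun i u t => gaussExp c Λ κ (x + u - θ * k i + t * p) with hh
  have hsum : ∀ i u, Summable (h i u) := fun i u => summable_gaussExp hc Λ κ p _
  set H : Fin p → Fin p → UnitAddCircle → ℂ := fun i u a => ∑' t, h i u t * fourier t a with hH
  have hHb : ∀ i u t (a : UnitAddCircle), ‖h i u t * fourier t a‖ ≤ ‖h i u t‖ := by
    intro i u t a
    rw [norm_mul, fourier_apply, Circle.norm_coe, mul_one]
  have hHc : ∀ i u, Continuous (H i u) := fun i u =>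
    continuous_tsum (fun t => by fun_prop) (hsum i u).norm fun t a => hHb i u t a
  have hHi : ∀ i u, Integrable (fun a => H i u a * f u a) AddCircle.haarAddCircle := fun i u =>
    (hfi u).bdd_mul (c := ∑' t, ‖h i u t‖) (hHc i u).aestronglyMeasurable
      (ae_of_all _ fun a => tsum_of_norm_bounded (hsum i u).norm.hasSum fun t => hHb i u t a)
  have hHz : ∀ i u (ζ : ℝ), H i u ζ = zakEntry c θ Λ κ p x ζ (k i) u := by
    intro i u ζ
    refine tsum_congr fun t => ?_
    rw [fourier_coe_apply]
    simp [hh]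
  have hzero : ∀ i, (∑ u, fun a => H i u a * f u a) =ᵐ[AddCircle.haarAddCircle] 0 := by
    intro i
    refine ae_eq_zero_of_fourierCoeff_eq_zero (integrable_finsetSum' _ fun u _ => hHi i u)
      fun s => ?_
    rw [fourierCoeff.sum _ _ fun u _ => hHi i u, Finset.sum_apply]
    have hk := hs (k i - q * s)
    refine Eq.trans (Finset.sum_congr rfl fun u _ => ?_)
      ((hasSum_int_divMod (p := p) hk.summable).unique hk)
    rw [← (hasSum_fourierCoeff_tsum_mul (hsum i u) (hfi u) s).tsum_eq,
      ← (Equiv.addRight s).tsum_eq]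
    refine tsum_congr fun t => ?_
    rw [Equiv.coe_addRight, hfc, mul_comm]
    have e1 : ((u : ℕ) : ℤ) - (s - (t + s)) * p = t * p + (u : ℕ) := by ring
    rw [e1]
    simp only [hh]
    congr 2
    push_cast
    linear_combination -(s : ℂ) * hqc
  have hf0 : ∀ᵐ a ∂(AddCircle.haarAddCircle : Measure UnitAddCircle), ∀ u, f u a = 0 := by
    filter_upwards [ae_all_iff.2 hzero, ae_haarAddCircle_notMem_of_countable hx] with a ha hdet u
    obtain ⟨ζ, rfl⟩ := QuotientAddGroup.mk_surjective a
    have hd := hdet ζ rfl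
    have := Matrix.eq_zero_of_mulVec_eq_zero (v := fun u => f u (ζ : UnitAddCircle)) hd <| by
      ext i
      have := ha i
      simp only [Finset.sum_apply, Pi.zero_apply] at this
      rw [Pi.zero_apply, ← this]
      simp only [Matrix.mulVec, dotProduct, Matrix.of_apply, ← hHz]
    exact congrFun this u
  obtain ⟨⟨t, u⟩, rfl⟩ := (Int.divModEquiv p).symm.surjective m
  have h1 := hfc u (-t)
  rw [fourierCoeff, integral_eq_zero_of_ae] at h1
  · rw [Int.divModEquiv_symm_apply, h1]
    congr 1
    ring
  · filter_upwards [hf0] with a ha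
    rw [ha u, smul_zero]
    rfl

lemma tsum_setLIntegral_comp_add_int (f : ℝ → ENNReal) :
    ∑' m : ℤ, ∫⁻ y in Set.Ioc (0 : ℝ) 1, f (y + m) = ∫⁻ y, f y := by
  have h1 : ∀ m : ℤ, ∫⁻ y in Set.Ioc (0 : ℝ) 1, f (y + m) =
      ∫⁻ y in Set.Ioc (m : ℝ) (m + 1), f y := by
    intro m
    have hpre : (fun y : ℝ => y + m) ⁻¹' Set.Ioc (m : ℝ) (m + 1) = Set.Ioc (0 : ℝ) 1 := by
      rw [Set.preimage_add_const_Ioc]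
      simp
    rw [← hpre]
    exact (measurePreserving_add_right volume (m : ℝ)).setLIntegral_comp_preimage_emb
      (measurableEmbedding_addRight (m : ℝ)) f _
  simp_rw [h1]
  rw [← lintegral_iUnion (fun m => measurableSet_Ioc) (Set.pairwise_disjoint_Ioc_intCast ℝ),
    iUnion_Ioc_intCast, setLIntegral_univ]

lemma ae_summable_norm_of_tsum_lintegral_ne_top {α ι : Type*} [Countable ι] [MeasurableSpace α]
    {μ : Measure α} {F : ι → α → ℂ} (hF : ∀ i, AEStronglyMeasurable (F i) μ)
    (h : ∑' i, ∫⁻ a, ‖F i a‖ₑ ∂μ ≠ ⊤) : ∀ᵐ a ∂μ, Summable fun i => ‖F i a‖ := by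
  rw [← lintegral_tsum fun i => (hF i).enorm] at h
  filter_upwards [ae_lt_top' (AEMeasurable.tsum fun i => (hF i).enorm) h] with a ha
  exact NNReal.summable_coe.2 (ENNReal.tsum_coe_ne_top_iff_summable.1 ha.ne)

lemma integrable_tsum_of_tsum_lintegral_ne_top {α ι : Type*} [Countable ι] [MeasurableSpace α]
    {μ : Measure α} {F : ι → α → ℂ} (hF : ∀ i, AEStronglyMeasurable (F i) μ)
    (h : ∑' i, ∫⁻ a, ‖F i a‖ₑ ∂μ ≠ ⊤) : Integrable (fun a => ∑' i, F i a) μ := by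
  refine ⟨aestronglyMeasurable_of_tendsto_ae (atTop : Filter (Finset ι))
    (f := fun s a => ∑ i ∈ s, F i a) (fun s => Finset.aestronglyMeasurable_fun_sum _ fun i _ => hF i) ?_,
    ?_⟩
  · filter_upwards [ae_summable_norm_of_tsum_lintegral_ne_top hF h] with a ha
    exact ha.of_norm.hasSum
  · rw [← lintegral_tsum fun i => (hF i).enorm] at h
    exact (lintegral_mono fun a => enorm_tsum_le_tsum_enorm).trans_lt (lt_top_iff_ne_top.2 h)

/-- An integrable function whose Fourier transform vanishes on `ℤ` has vanishing periodization. -/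
theorem ae_hasSum_comp_add_int_eq_zero {Q : ℝ → ℂ} (hQ : Integrable Q)
    (h : ∀ l : ℤ, ∫ y : ℝ, Complex.exp (2 * π * I * l * y) * Q y = 0) :
    ∀ᵐ y ∂volume.restrict (Set.Ioc (0 : ℝ) 1), HasSum (fun m : ℤ => Q (y + m)) 0 := by
  have hm : ∀ m : ℤ, AEStronglyMeasurable (fun y : ℝ => Q (y + m))
      (volume.restrict (Set.Ioc (0 : ℝ) 1)) := fun m => (hQ.comp_add_right (m : ℝ)).1.restrict
  have hfin : ∑' m : ℤ, ∫⁻ y in Set.Ioc (0 : ℝ) 1, ‖Q (y + m)‖ₑ ≠ ⊤ := by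
    rw [tsum_setLIntegral_comp_add_int fun y => ‖Q y‖ₑ]
    exact hQ.2.ne
  have hsum := ae_summable_norm_of_tsum_lintegral_ne_top hm hfin
  have hint := integrable_tsum_of_tsum_lintegral_ne_top hm hfin
  have hP : Integrable (AddCircle.liftIoc 1 0 fun y : ℝ => ∑' m : ℤ, Q (y + m))
      (AddCircle.haarAddCircle : Measure UnitAddCircle) := by
    rw [← memLp_one_iff_integrable, memLp_haarAddCircle_iff]
    refine MemLp.memLp_liftIoc (T := 1) ?_
    rw [memLp_one_iff_integrable, zero_add]
    exact hint
  have hcoeff : ∀ n : ℤ, fourierCoeff (AddCircle.liftIoc (1 : ℝ) 0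
      fun y : ℝ => ∑' m : ℤ, Q (y + m)) n = 0 := by
    intro n
    rw [fourierCoeff_liftIoc_eq, fourierCoeffOn_eq_integral]
    have hmul : ∀ m : ℤ, AEStronglyMeasurable (fun y : ℝ =>
        Complex.exp (2 * π * I * (-n : ℤ) * (y + m : ℝ)) * Q (y + m))
        (volume.restrict (Set.Ioc (0 : ℝ) 1)) := fun m =>
      AEStronglyMeasurable.mul (Continuous.aestronglyMeasurable (by fun_prop)) (hm m)
    have hnorm : ∀ x : ℝ, ‖Complex.exp (2 * π * I * (-n : ℤ) * x)‖ₑ = 1 := by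
      intro x
      have : 2 * π * I * (-n : ℤ) * x = ((2 * π * (-n : ℤ) * x : ℝ) : ℂ) * I := by
        push_cast; ring
      rw [← ofReal_norm, this, Complex.norm_exp_ofReal_mul_I, ENNReal.ofReal_one]
    have hf : Integrable fun y : ℝ => Complex.exp (2 * π * I * (-n : ℤ) * y) * Q y := by
      refine hQ.bdd_mul (c := 1) (Continuous.aestronglyMeasurable (by fun_prop))
        (ae_of_all _ fun x => ?_)
      rw [← norm_one (α := ℝ), ← enorm_le_iff_norm_le, hnorm, enorm_one]
    have h1 := hf.hasSum_intervalIntegral_comp_add_int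
    rw [h] at h1
    have h2 := integral_tsum hmul (by
      simp_rw [enorm_mul, hnorm, one_mul]
      exact hfin)
    have h3 : ∫ y in (0 : ℝ)..(0 + 1), fourier (-n) (y : AddCircle ((0 : ℝ) + 1 - 0)) •
        ∑' m : ℤ, Q (y + m) = ∑' m : ℤ, ∫ y in Set.Ioc (0 : ℝ) 1,
          Complex.exp (2 * π * I * (-n : ℤ) * (y + m : ℝ)) * Q (y + m) := by
      rw [← h2, intervalIntegral.integral_of_le (by norm_num), zero_add]
      refine integral_congr_ae (ae_of_all _ fun y => ?_)
      simp only
      rw [smul_eq_mul, ← tsum_mul_left]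
      refine tsum_congr fun m => ?_
      congr 1
      rw [fourier_coe_apply, ← Complex.exp_periodic.int_mul (-n * m)]
      congr 1
      push_cast
      ring
    rw [h3]
    simp_rw [intervalIntegral.integral_of_le zero_le_one] at h1
    rw [h1.tsum_eq, smul_zero]
  have h0 := ae_eq_zero_of_fourierCoeff_eq_zero hP hcoeff
  have h1 : ∀ᵐ y ∂volume.restrict (Set.Ioc (0 : ℝ) 1),
      AddCircle.liftIoc (1 : ℝ) 0 (fun y : ℝ => ∑' m : ℤ, Q (y + m)) (y : ℝ) = 0 := by
    have hmp := UnitAddCircle.measurePreserving_mk 0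
    rw [AddCircle.volume_eq_smul_haarAddCircle, ENNReal.ofReal_one, one_smul, zero_add] at hmp
    exact hmp.quasiMeasurePreserving.ae h0
  filter_upwards [hsum, h1, ae_restrict_mem measurableSet_Ioc] with y hy h2 hmem
  rw [AddCircle.liftIoc_coe_apply (by simpa using hmem)] at h2
  exact h2 ▸ hy.of_norm.hasSum

lemma memLp_gaussExp_comp {c : ℝ} (hc : 0 < c) (Λ : Finset ℂ) (κ : ℂ → ℂ) {a : ℝ} (ha : a ≠ 0)
    (b : ℝ) : MemLp (fun x : ℝ => gaussExp c Λ κ (a * x + b)) 2 := by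
  refine memLp_finsetSum _ fun l _ => MemLp.const_mul ?_ _
  rw [memLp_two_iff_integrable_sq_norm (Continuous.aestronglyMeasurable (by fun_prop))]
  have hB : (-2 * c * a ^ 2 : ℂ).re < 0 := by
    have : (-2 * c * a ^ 2 : ℂ) = ((-2 * c * a ^ 2 : ℝ) : ℂ) := by push_cast; ring
    rw [this, Complex.ofReal_re]
    have : 0 < c * a ^ 2 := by positivity
    linarith
  refine (integrable_cexp_quadratic' hB (2 * l * a - 4 * c * a * b)
    (-2 * c * b ^ 2 + 2 * l * b)).norm.congr (ae_of_all _ fun x => ?_)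
  simp only
  rw [← norm_pow, ← Complex.exp_nat_mul]
  congr 2
  push_cast
  ring

/-- Zak-transform uniqueness: a square-integrable function orthogonal to the Gabor system of
`gaussExp` over a rational lattice of density at least one vanishes. -/
theorem ae_eq_zero_of_integral_mul_gaussExp {c θ : ℝ} (hc : 0 < c) (hθ : 0 < θ) {p q : ℕ} [NeZero p]
    (hq : θ * q = p) (h : θ < 1 ∨ p = 1) {Λ : Finset ℂ} (hΛ : Λ.Nonempty) {κ : ℂ → ℂ}
    (hκ : ∀ l ∈ Λ, κ l ≠ 0) {F : ℝ → ℂ} (hF : MemLp F 2)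
    (hint : ∀ k l : ℤ, ∫ y : ℝ, Complex.exp (2 * π * I * l * y) *
      (F y * gaussExp c Λ κ (y - θ * k)) = 0) : F =ᵐ[volume] 0 := by
  obtain ⟨k, S, hS, hdet⟩ := exists_countable_det_zakEntry (p := p) hc hθ h hΛ hκ
  have hper : ∀ᵐ y ∂volume.restrict (Set.Ioc (0 : ℝ) 1), ∀ k : ℤ, HasSum (fun m : ℤ =>
      F (y + m) * gaussExp c Λ κ ((y + m : ℝ) - θ * k)) 0 := by
    refine ae_all_iff.2 fun k => ae_hasSum_comp_add_int_eq_zero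
      (Q := fun y => F y * gaussExp c Λ κ (y - θ * k)) ?_ (hint k)
    have hG : MemLp (fun y : ℝ => gaussExp c Λ κ (y - θ * k)) 2 := by
      simpa [sub_eq_add_neg] using memLp_gaussExp_comp hc Λ κ one_ne_zero (-(θ * k))
    exact hF.integrable_mul hG
  have hsq : ∀ᵐ y ∂volume.restrict (Set.Ioc (0 : ℝ) 1), Summable fun m : ℤ => ‖F (y + m)‖ ^ 2 := by
    have hF2 : Integrable fun y => F y ^ 2 := by
      simp_rw [pow_two]
      exact hF.integrable_mul hF
    have := ae_summable_norm_of_tsum_lintegral_ne_top (F := fun (m : ℤ) (y : ℝ) => F (y + m) ^ 2)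
      (μ := volume.restrict (Set.Ioc (0 : ℝ) 1))
      (fun m => (hF2.comp_add_right (m : ℝ)).1.restrict) (by
        rw [tsum_setLIntegral_comp_add_int fun y => ‖F y ^ 2‖ₑ]
        exact hF2.2.ne)
    simpa using this
  have hzero : ∀ᵐ y ∂volume.restrict (Set.Ioc (0 : ℝ) 1), ∀ m : ℤ, F (y + m) = 0 := by
    filter_upwards [hper, hsq, hS.ae_notMem _] with y h1 h2 h3
    refine eq_zero_of_hasSum_mul_gaussExp hc hq (hdet y h3) h2 fun k => ?_
    simpa using h1 k
  have hl : ∫⁻ y, ‖F y‖ₑ = 0 := by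
    rw [← tsum_setLIntegral_comp_add_int]
    refine ENNReal.tsum_eq_zero.2 fun m => ?_
    rw [lintegral_congr_ae (g := fun _ => 0), lintegral_zero]
    filter_upwards [hzero] with y hy
    rw [hy m, enorm_zero]
  filter_upwards [(lintegral_eq_zero_iff' hF.1.enorm).1 hl] with y hy
  simpa using hy

lemma exists_gaussExp_eq {n : ℕ} {a b : Fin n → ℝ} {d : Fin n → ℂ} {g : ℝ → ℂ}
    (hg : ∀ x : ℝ, g x = ∑ j : Fin n, d j * (Complex.exp (2 * π * I * (b j * x)) *
      Complex.exp (-π * (x - a j) ^ 2)))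
    (hgnz : ∃ x : ℝ, g x ≠ 0) {β : ℝ} (hβ : 0 < β) :
    ∃ (Λ : Finset ℂ) (κ : ℂ → ℂ), Λ.Nonempty ∧ (∀ l ∈ Λ, κ l ≠ 0) ∧
      ∀ x : ℝ, g x = gaussExp (π / β ^ 2) Λ κ (β * x) := by
  classical
  have hβ' : (β : ℂ) ≠ 0 := by exact_mod_cast hβ.ne'
  set ℓ : Fin n → ℂ := fun j => (2 * π * a j + 2 * π * I * b j) / β with hℓ
  set κ : ℂ → ℂ := fun l => ∑ j with ℓ j = l, d j * Complex.exp (-π * a j ^ 2) with hκ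
  have hgκ : ∀ x : ℝ, g x = gaussExp (π / β ^ 2)
      ((Finset.univ.image ℓ).filter fun l => κ l ≠ 0) κ (β * x) := by
    intro x
    rw [hg, gaussExp, Finset.sum_filter_of_ne fun l _ hl => left_ne_zero_of_mul hl,
      ← Finset.sum_fiberwise_of_maps_to (g := ℓ) (t := Finset.univ.image ℓ)
        fun j _ => Finset.mem_image_of_mem _ (Finset.mem_univ j)]
    refine Finset.sum_congr rfl fun l _ => ?_
    simp only [hκ]
    rw [Finset.sum_mul]
    refine Finset.sum_congr rfl fun j hj => ?_
    rw [← (Finset.mem_filter.1 hj).2, mul_assoc (d j), ← Complex.exp_add, ← Complex.exp_add]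
    congr 2
    simp only [hℓ]
    push_cast
    field_simp
    ring
  refine ⟨_, κ, ?_, fun l hl => (Finset.mem_filter.1 hl).2, hgκ⟩
  obtain ⟨x, hx⟩ := hgnz
  rw [hgκ] at hx
  exact Finset.nonempty_of_sum_ne_zero hx

/-- Completeness criterion: an `L²` function orthogonal to the Gabor system vanishes. -/
lemma gaborComplete_of_forall_integral {g : ℝ → ℂ} {α β : ℝ}
    (hg : ∀ k l : ℤ, MemLp (fun x : ℝ =>
      Complex.exp (2 * π * I * (β * l * x)) * g (x - α * k)) 2)
    (h : ∀ f : ℝ → ℂ, StronglyMeasurable f → MemLp f 2 →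
      (∀ k l : ℤ, ∫ x : ℝ, (starRingEnd ℂ) (f x) *
        (Complex.exp (2 * π * I * (β * l * x)) * g (x - α * k)) = 0) → f =ᵐ[volume] 0) :
    GaborComplete g α β := by
  rw [GaborComplete, Submodule.topologicalClosure_eq_top_iff, Submodule.eq_bot_iff]
  intro f hf
  refine Lp.ext ((h f (Lp.stronglyMeasurable f) (Lp.memLp f) fun k l => ?_).trans
    (Lp.coeFn_zero _ _ _).symm)
  have h1 := (Submodule.mem_orthogonal' _ _).1 hf _
    (Submodule.subset_span ⟨k, l, (hg k l).coeFn_toLp⟩)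
  rw [L2.inner_def] at h1
  rw [← h1]
  refine integral_congr_ae ?_
  filter_upwards [(hg k l).coeFn_toLp] with x hx
  rw [RCLike.inner_apply', hx]

end

theorem stmt_6 (n : ℕ) (hn : 1 ≤ n) (a b : Fin n → ℝ) (d : Fin n → ℂ)
    (g : ℝ → ℂ)
    (hg : ∀ x : ℝ, g x = ∑ j : Fin n, d j * (Complex.exp (2 * Real.pi * Complex.I * (b j * x)) *
      Complex.exp (-(Real.pi) * (x - a j) ^ 2)))
    (hgnz : ∃ x : ℝ, g x ≠ 0)
    (α β : ℝ) (hα : 0 < α) (hβ : 0 < β)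
    (hrat : ∃ r : ℚ, α * β = (r : ℝ)) (hle : α * β ≤ 1) :
    GaborComplete g α β := by
  obtain ⟨Λ, κ, hΛ, hκ, hgΛ⟩ := exists_gaussExp_eq hg hgnz hβ
  obtain ⟨r, hr⟩ := hrat
  have hc : 0 < π / β ^ 2 := div_pos Real.pi_pos (pow_pos hβ 2)
  have hθ : 0 < α * β := mul_pos hα hβ
  have hr0 : 0 < r := by exact_mod_cast hr ▸ hθ
  have hshift : ∀ (k : ℤ) (x : ℝ),
      g (x - α * k) = gaussExp (π / β ^ 2) Λ κ (β * x - (α * β : ℝ) * k) := by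
    intro k x
    rw [hgΛ]
    congr 1
    push_cast
    ring
  obtain ⟨p, hp⟩ := Int.eq_ofNat_of_zero_le (Rat.num_pos.2 hr0).le
  have hp0 : p ≠ 0 := by
    rintro rfl
    exact (Rat.num_pos.2 hr0).ne' hp
  have : NeZero p := ⟨hp0⟩
  have hq : α * β * (r.den : ℕ) = p := by
    rw [hr]
    have h1 : r * r.den = r.num := Rat.mul_den_eq_num r
    rw [hp] at h1
    exact_mod_cast h1
  have hor : α * β < 1 ∨ p = 1 := by
    rcases hle.lt_or_eq with h | h
    · exact Or.inl h
    · right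
      have h1 : r = 1 := by exact_mod_cast hr.symm.trans h
      rw [h1, Rat.num_one] at hp
      exact_mod_cast hp.symm
  refine gaborComplete_of_forall_integral (fun k l => ?_) fun f hfm hf hint => ?_
  · simp_rw [hshift]
    have h1 := memLp_gaussExp_comp hc Λ κ hβ.ne' (-(α * β * k))
    refine (h1.of_le_mul (c := 1) (AEStronglyMeasurable.mul
      (Continuous.aestronglyMeasurable (by fun_prop)) ?_) (ae_of_all _ fun x => ?_))
    · simpa [sub_eq_add_neg] using h1.1
    · have : 2 * π * I * (β * l * x) = ((2 * π * (β * l * x) : ℝ) : ℂ) * I := by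
        push_cast; ring
      rw [norm_mul, this, Complex.norm_exp_ofReal_mul_I]
      simp [sub_eq_add_neg]
  · have hdm : Measurable fun y : ℝ => y / β := measurable_id.div_const β
    have hFm : StronglyMeasurable fun y : ℝ => (starRingEnd ℂ) (f (y / β)) :=
      Complex.continuous_conj.comp_stronglyMeasurable (hfm.comp_measurable hdm)
    have hF : MemLp (fun y : ℝ => (starRingEnd ℂ) (f (y / β))) 2 := by
      rw [memLp_two_iff_integrable_sq_norm hFm.aestronglyMeasurable]
      have := ((memLp_two_iff_integrable_sq_norm hf.1).1 hf).comp_div hβ.ne'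
      simpa using this
    have h0 := ae_eq_zero_of_integral_mul_gaussExp hc hθ hq hor hΛ hκ hF fun k l => by
      have h1 := Measure.integral_comp_mul_left (fun y : ℝ => Complex.exp (2 * π * I * l * y) *
        ((starRingEnd ℂ) (f (y / β)) * gaussExp (π / β ^ 2) Λ κ (y - (α * β : ℝ) * k))) β
      have h2 : ∫ x : ℝ, Complex.exp (2 * π * I * l * (β * x : ℝ)) *
          ((starRingEnd ℂ) (f (β * x / β)) *
            gaussExp (π / β ^ 2) Λ κ ((β * x : ℝ) - (α * β : ℝ) * k)) = 0 := by
        rw [← hint k l]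
        refine integral_congr_ae (ae_of_all _ fun x => ?_)
        simp only
        rw [hshift, mul_div_cancel_left₀ _ hβ.ne', mul_left_comm]
        congr 3
        · push_cast
          ring
        · push_cast
          ring
      rw [h2] at h1
      exact (smul_eq_zero.1 h1.symm).resolve_left (abs_ne_zero.2 (inv_ne_zero hβ.ne'))
    have hqmp : Measure.QuasiMeasurePreserving (fun x : ℝ => β * x) volume volume :=
      ⟨measurable_const_mul β, by
        rw [Real.map_volume_mul_left hβ.ne']
        exact Measure.smul_absolutelyContinuous⟩
    filter_upwards [hqmp.ae h0] with x hx
    rw [mul_div_cancel_left₀ _ hβ.ne'] at hx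
    simpa using hx
end

section
/- Let g : ℝ → ℂ be continuous with ∑_{k∈ℤ} sup_{x∈[0,α]} |g(x − αk)| < ∞, and assume g belongs to the Feichtinger algebra M¹(ℝ), i.e., ∫_{ℝ²} |⟨g, M_ξ T_x g⟩| dx dξ < ∞ where ⟨·,·⟩ is the L² inner product, M_ξ f(t) = e^{2πiξt} f(t) and T_x f(t) = f(t − x). Let α, β > 0 with αβ = p/q for coprime positive integers p, q. Then the following are equivalent: (i) the Gabor system G(g, α, β) is a frame for L²(ℝ); (ii) det A_g(x, ξ) ≠ 0 for all (x, ξ) ∈ ℝ²; (iii) the matrix Q_g(x, ξ) has full rank p for all (x, ξ) ∈ ℝ². -/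
open MeasureTheory Complex Real Matrix

/-- The Gabor system `G(g, α, β)` is a frame for `L²(ℝ)`: there are `A, B > 0` with
`A‖f‖² ≤ ∑_{k,l∈ℤ} |⟨f, e^{2πiβl·} g(· − αk)⟩|² ≤ B‖f‖²` for all `f ∈ L²(ℝ)`. -/
def GaborFrame (g : ℝ → ℂ) (α β : ℝ) : Prop :=
  ∃ A B : ℝ, 0 < A ∧ 0 < B ∧ ∀ f : Lp ℂ 2 (volume : Measure ℝ),
    A * ‖f‖ ^ 2 ≤ ∑' kl : ℤ × ℤ,
        ‖∫ x : ℝ, f x * (starRingEnd ℂ)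
          (Complex.exp (2 * Real.pi * Complex.I * (β * kl.2 * x)) * g (x - α * kl.1))‖ ^ 2 ∧
      (∑' kl : ℤ × ℤ,
        ‖∫ x : ℝ, f x * (starRingEnd ℂ)
          (Complex.exp (2 * Real.pi * Complex.I * (β * kl.2 * x)) * g (x - α * kl.1))‖ ^ 2)
        ≤ B * ‖f‖ ^ 2

/-- The Zak transform `Z_α g(x, ξ) = ∑_{k∈ℤ} g(x − αk) e^{2πiαkξ}`. -/
noncomputable def zak (g : ℝ → ℂ) (α x ξ : ℝ) : ℂ :=
  ∑' k : ℤ, g (x - α * k) * Complex.exp (2 * Real.pi * Complex.I * (α * k * ξ))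

/-- The `p × q` Zibulski–Zeevi matrix
`Q_g(x, ξ)_{jk} = Z_α g(x + αj/p, ξ − βk) e^{2πijk/q}`. -/
noncomputable def Qmat (g : ℝ → ℂ) (α β : ℝ) (p q : ℕ) (x ξ : ℝ) :
    Matrix (Fin p) (Fin q) ℂ :=
  fun j k => zak g α (x + α * j / p) (ξ - β * k) *
    Complex.exp (2 * Real.pi * Complex.I * ((j : ℝ) * k / q))

/-- The `p × p` matrix `A_g(x, ξ) = Q_g(x, ξ) Q_g(x, ξ)*`. -/
noncomputable def Amat (g : ℝ → ℂ) (α β : ℝ) (p q : ℕ) (x ξ : ℝ) :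
    Matrix (Fin p) (Fin p) ℂ :=
  Qmat g α β p q x ξ * (Qmat g α β p q x ξ)ᴴ

/-- The character `t ↦ e^{2πit}`. -/
noncomputable def expTwoPiI (t : ℝ) : ℂ := Complex.exp (2 * Real.pi * Complex.I * t)

lemma expTwoPiI_add (s t : ℝ) : expTwoPiI (s + t) = expTwoPiI s * expTwoPiI t := by
  simp only [expTwoPiI, ← Complex.exp_add]
  congr 1
  push_cast
  ring

lemma expTwoPiI_int (n : ℤ) : expTwoPiI n = 1 := by
  rw [expTwoPiI, Complex.exp_eq_one_iff]
  exact ⟨n, by push_cast; ring⟩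

lemma expTwoPiI_zero : expTwoPiI 0 = 1 := by
  simpa using expTwoPiI_int 0

lemma expTwoPiI_add_int (t : ℝ) (n : ℤ) : expTwoPiI (t + n) = expTwoPiI t := by
  rw [expTwoPiI_add, expTwoPiI_int, mul_one]

lemma norm_expTwoPiI (t : ℝ) : ‖expTwoPiI t‖ = 1 := by
  rw [expTwoPiI, Complex.norm_exp]
  simp

lemma expTwoPiI_ne_zero (t : ℝ) : expTwoPiI t ≠ 0 := Complex.exp_ne_zero _

lemma conj_expTwoPiI (t : ℝ) : (starRingEnd ℂ) (expTwoPiI t) = expTwoPiI (-t) := by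
  rw [expTwoPiI, expTwoPiI, ← Complex.exp_conj]
  congr 1
  simp [Complex.conj_ofNat]

lemma continuous_expTwoPiI : Continuous expTwoPiI := by
  unfold expTwoPiI
  fun_prop

lemma fourier_unit_coe (n : ℤ) (t : ℝ) :
    fourier n (t : UnitAddCircle) = expTwoPiI (n * t) := by
  rw [fourier_coe_apply, expTwoPiI]
  congr 1
  push_cast
  ring

/-- Parseval's identity on an interval of length one. -/
lemma hasSum_sq_integral_expTwoPiI {F : ℝ → ℂ} {a : ℝ}
    (hF : MemLp F 2 (volume.restrict (Set.Ioc a (a + 1)))) :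
    HasSum (fun l : ℤ => ‖∫ y in a..(a + 1), expTwoPiI (-(l * y)) * F y‖ ^ 2)
      (∫ y in a..(a + 1), ‖F y‖ ^ 2) := by
  have hab : a < a + 1 := by linarith
  have h := hasSum_sq_fourierCoeffOn hab hF
  simp only [fourierCoeffOn_eq_integral, add_sub_cancel_left, inv_one, one_smul, div_one] at h
  have h1 : ∀ (l : ℤ) (y : ℝ), (fourier (-l) (y : AddCircle (a + 1 - a)) : ℂ) =
      expTwoPiI (-(l * y)) := by
    intro l y
    rw [fourier_coe_apply, expTwoPiI]
    congr 1
    push_cast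
    ring
  simpa only [h1, smul_eq_mul] using h

/-- Parseval's identity for an absolutely convergent Fourier series. -/
lemma hasSum_sq_of_summable {b : ℤ → ℂ} (hb : Summable fun k => ‖b k‖) :
    HasSum (fun k => ‖b k‖ ^ 2)
      (∫ t in (0 : ℝ)..1, ‖∑' k, b k * expTwoPiI (k * t)‖ ^ 2) := by
  have hs : Summable fun k : ℤ => b k • (fourier k : C(UnitAddCircle, ℂ)) := by
    refine Summable.of_norm ?_
    simpa [norm_smul, fourier_norm] using hb
  set S : C(UnitAddCircle, ℂ) := ∑' k : ℤ, b k • (fourier k : C(UnitAddCircle, ℂ)) with hS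
  have hSt (t : ℝ) : S (t : UnitAddCircle) = ∑' k, b k * expTwoPiI (k * t) := by
    rw [← (ContinuousMap.hasSum_apply hs.hasSum (t : UnitAddCircle)).tsum_eq]
    refine tsum_congr fun k => ?_
    rw [← fourier_unit_coe]
    rfl
  have hcoef (i : ℤ) : fourierCoeff S i = b i := by
    have h1 := (hs.hasSum.mapL (ContinuousMap.toLp (E := ℂ) 2
      (AddCircle.haarAddCircle (T := (1 : ℝ))) ℂ)).mapL
      (innerSL ℂ (fourierLp (T := (1 : ℝ)) 2 i))
    have h2 : ∀ k : ℤ, innerSL ℂ (fourierLp (T := (1 : ℝ)) 2 i)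
        (ContinuousMap.toLp (E := ℂ) 2 (AddCircle.haarAddCircle (T := (1 : ℝ))) ℂ
          (b k • (fourier k : C(UnitAddCircle, ℂ)))) = if k = i then b i else 0 := by
      intro k
      have := (orthonormal_iff_ite.mp (orthonormal_fourier (T := (1 : ℝ)))) i k
      rw [map_smul, innerSL_apply_apply, inner_smul_right]
      change b k * inner ℂ (fourierLp (T := (1 : ℝ)) 2 i) (fourierLp (T := (1 : ℝ)) 2 k) = _
      rw [this]
      by_cases hk : i = k
      · simp [hk]
      · simp [hk, Ne.symm hk]
    simp only [h2] at h1
    have h3 := h1.unique (hasSum_ite_eq i (b i))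
    rw [← h3, ← fourierCoeff_toLp, ← fourierBasis_repr, HilbertBasis.repr_apply_apply,
      coe_fourierBasis, innerSL_apply_apply]
  have h := hasSum_sq_fourierCoeff (ContinuousMap.toLp (E := ℂ) 2
      (AddCircle.haarAddCircle (T := (1 : ℝ))) ℂ S)
  simp only [fourierCoeff_toLp, hcoef] at h
  convert! h using 1
  have h4 : ∫ t, ‖(ContinuousMap.toLp (E := ℂ) 2
      (AddCircle.haarAddCircle (T := (1 : ℝ))) ℂ S) t‖ ^ 2 ∂AddCircle.haarAddCircle
      = ∫ t, ‖S t‖ ^ 2 ∂(AddCircle.haarAddCircle (T := (1 : ℝ))) := by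
    refine integral_congr_ae ?_
    filter_upwards [ContinuousMap.coeFn_toLp (p := 2) (𝕜 := ℂ)
      (AddCircle.haarAddCircle (T := (1 : ℝ))) S] with t ht
    rw [ht]
  rw [h4]
  have h5 := AddCircle.intervalIntegral_preimage (1 : ℝ) 0 (fun t => ‖S t‖ ^ 2)
  rw [AddCircle.integral_haarAddCircle, ← h5]
  simp only [hSt]
  simp

/-- Folding an interval average along the `q`-th roots of unity. -/
lemma integral_eq_sum_integral_div {H : ℝ → ℝ} (hH : Continuous H) {q : ℕ} (hq : 0 < q) :
    ∫ t in (0 : ℝ)..1, H t =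
      (q : ℝ)⁻¹ * ∫ t in (0 : ℝ)..1, ∑ j : Fin q, H ((t + (j : ℕ)) / q) := by
  have hq' : (q : ℝ) ≠ 0 := by positivity
  have h1 : ∀ j : ℕ, ∫ t in (0 : ℝ)..1, H ((t + j) / q) =
      q * ∫ t in ((j : ℝ) / q)..(((j + 1 : ℕ) : ℝ) / q), H t := by
    intro j
    have := intervalIntegral.integral_comp_div_add (a := (0 : ℝ)) (b := 1) H hq' ((j : ℝ) / q)
    simp only [smul_eq_mul] at this
    rw [show (fun t : ℝ => H ((t + j) / q)) = fun t : ℝ => H (t / q + j / q) by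
      ext t; rw [add_div], this]
    congr 2 <;> push_cast <;> ring
  rw [intervalIntegral.integral_finsetSum]
  · rw [Fin.sum_univ_eq_sum_range (fun j : ℕ => ∫ t in (0 : ℝ)..1, H ((t + j) / q)) q,
      Finset.sum_congr rfl fun j _ => h1 j, ← Finset.mul_sum,
      intervalIntegral.sum_integral_adjacent_intervals
        (a := fun j : ℕ => (j : ℝ) / q) fun k _ => hH.intervalIntegrable _ _]
    field_simp
    simp
  · intro j _
    exact (hH.comp (by fun_prop)).intervalIntegrable _ _

/-- On every bounded set the translates `g (x - α k)` are dominated by a summable sequence. -/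
def TranslatesDominated (g : ℝ → ℂ) (α : ℝ) : Prop :=
  ∀ J : ℕ, ∃ u : ℤ → ℝ, Summable u ∧ ∀ x, |x| ≤ α * J → ∀ k : ℤ, ‖g (x - α * k)‖ ≤ u k

lemma norm_le_iSup_Icc {g : ℝ → ℂ} (hg : Continuous g) (α : ℝ) (k : ℤ) {x : ℝ}
    (hx : x ∈ Set.Icc (0 : ℝ) α) :
    ‖g (x - α * k)‖ ≤ ⨆ x ∈ Set.Icc (0 : ℝ) α, ‖g (x - α * k)‖ := by
  obtain ⟨C, hC⟩ := (isCompact_Icc (a := (0 : ℝ)) (b := α)).exists_bound_of_continuousOn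
    (f := fun x => g (x - α * k)) (by fun_prop)
  have hC0 : 0 ≤ C := (norm_nonneg _).trans (hC x hx)
  have hb : BddAbove (Set.range fun x => ⨆ _ : x ∈ Set.Icc (0 : ℝ) α, ‖g (x - α * k)‖) := by
    refine ⟨C, ?_⟩
    rintro _ ⟨y, rfl⟩
    exact Real.iSup_le (fun hy => hC y hy) hC0
  refine le_trans ?_ (le_ciSup hb x)
  simp [hx.1, hx.2]

lemma exists_eq_add_mul_int {α : ℝ} (hα : 0 < α) (x : ℝ) :
    ∃ r ∈ Set.Icc (0 : ℝ) α, x = r + α * ⌊x / α⌋ := by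
  refine ⟨x - α * ⌊x / α⌋, ⟨?_, ?_⟩, by ring⟩
  · have := Int.floor_le (x / α)
    rw [le_div_iff₀ hα] at this
    linarith
  · have := Int.lt_floor_add_one (x / α)
    rw [div_lt_iff₀ hα] at this
    linarith

lemma translatesDominated {g : ℝ → ℂ} (hg : Continuous g) {α : ℝ} (hα : 0 < α)
    (hsum : Summable fun k : ℤ => ⨆ x ∈ Set.Icc (0 : ℝ) α, ‖g (x - α * k)‖) :
    TranslatesDominated g α := by
  intro J
  let M : ℤ → ℝ := fun k => ⨆ x ∈ Set.Icc (0 : ℝ) α, ‖g (x - α * k)‖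
  have hM0 : ∀ k, 0 ≤ M k := fun k =>
    Real.iSup_nonneg fun x => Real.iSup_nonneg fun _ => norm_nonneg _
  have hMj : ∀ j : ℤ, Summable fun k => M (k - j) := fun j =>
    (Equiv.subRight j).summable_iff (f := M) |>.mpr hsum
  refine ⟨fun k => ∑ j ∈ Finset.Icc (-(J : ℤ)) J, M (k - j), summable_sum fun j _ => hMj j, ?_⟩
  intro x hx k
  obtain ⟨r, hr, hxr⟩ := exists_eq_add_mul_int hα x
  have hj : ⌊x / α⌋ ∈ Finset.Icc (-(J : ℤ)) J := by
    rw [abs_le] at hx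
    rw [Finset.mem_Icc]
    constructor
    · rw [Int.le_floor, le_div_iff₀ hα]
      push_cast
      linarith
    · have : (⌊x / α⌋ : ℝ) ≤ J := (Int.floor_le _).trans (by
        rw [div_le_iff₀ hα]; linarith)
      exact_mod_cast this
  refine le_trans ?_ (Finset.single_le_sum (f := fun j => M (k - j)) (fun j _ => hM0 _) hj)
  have h := norm_le_iSup_Icc hg α (k - ⌊x / α⌋) hr
  have e : x - α * k = r - α * ((k - ⌊x / α⌋ : ℤ) : ℝ) := by
    push_cast
    linarith
  rw [e]
  exact h

lemma exists_norm_le {g : ℝ → ℂ} (hg : Continuous g) {α : ℝ} (hα : 0 < α)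
    (hsum : Summable fun k : ℤ => ⨆ x ∈ Set.Icc (0 : ℝ) α, ‖g (x - α * k)‖) :
    ∃ B, ∀ x, ‖g x‖ ≤ B := by
  refine ⟨∑' k : ℤ, ⨆ x ∈ Set.Icc (0 : ℝ) α, ‖g (x - α * k)‖, fun x => ?_⟩
  obtain ⟨r, hr, hxr⟩ := exists_eq_add_mul_int hα x
  have h := norm_le_iSup_Icc hg α (-⌊x / α⌋) hr
  refine le_trans ?_ (hsum.le_tsum (-⌊x / α⌋) fun k _ =>
    Real.iSup_nonneg fun x => Real.iSup_nonneg fun _ => norm_nonneg _)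
  have e : x = r - α * ((-⌊x / α⌋ : ℤ) : ℝ) := by
    push_cast
    linarith
  rw [← e] at h
  exact h

lemma memLp_two_of_summable_iSup {g : ℝ → ℂ} (hg : Continuous g) {α : ℝ} (hα : 0 < α)
    (hsum : Summable fun k : ℤ => ⨆ x ∈ Set.Icc (0 : ℝ) α, ‖g (x - α * k)‖) :
    MemLp g 2 volume := by
  obtain ⟨B, hB⟩ := exists_norm_le hg hα hsum
  have hB0 : 0 ≤ B := (norm_nonneg _).trans (hB 0)
  rw [memLp_two_iff_integrable_sq_norm hg.aestronglyMeasurable]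
  let f : C(ℝ, ℝ) := ⟨fun x => ‖g x‖ ^ 2, by fun_prop⟩
  let s : ℤ → TopologicalSpace.Compacts ℝ := fun k => ⟨Set.Icc (-(α * k)) (α - α * k), isCompact_Icc⟩
  have hμ : ∀ k, volume.real (s k : Set ℝ) = α := by
    intro k
    change volume.real (Set.Icc (-(α * k)) (α - α * k)) = α
    rw [Real.volume_real_Icc_of_le (by linarith)]
    ring
  refine integrable_of_summable_norm_restrict (f := f) (s := s) ?_ ?_
  · simp only [hμ]
    refine Summable.mul_right _ ?_
    refine Summable.of_nonneg_of_le (fun k => norm_nonneg _) (fun k => ?_) (hsum.mul_left B)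
    refine (ContinuousMap.norm_le _ (mul_nonneg hB0
      (Real.iSup_nonneg fun x => Real.iSup_nonneg fun _ => norm_nonneg _))).mpr ?_
    rintro ⟨x, hx⟩
    have hx' : x + α * k ∈ Set.Icc (0 : ℝ) α :=
      ⟨by linarith [(show x ∈ Set.Icc _ _ from hx).1], by linarith [(show x ∈ Set.Icc _ _ from hx).2]⟩
    have h := norm_le_iSup_Icc hg α k hx'
    rw [add_sub_cancel_right] at h
    change ‖‖g x‖ ^ 2‖ ≤ _
    rw [norm_pow, norm_norm, pow_two]
    exact mul_le_mul (hB x) h (norm_nonneg _) hB0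
  · rw [Set.eq_univ_iff_forall]
    intro x
    obtain ⟨r, hr, hxr⟩ := exists_eq_add_mul_int hα x
    refine Set.mem_iUnion.mpr ⟨-⌊x / α⌋, ?_⟩
    change x ∈ Set.Icc _ _
    push_cast
    exact ⟨by linarith [hr.1], by linarith [hr.2]⟩

lemma TranslatesDominated.summable_norm {g : ℝ → ℂ} {α : ℝ} (hW : TranslatesDominated g α)
    (hα : 0 < α) (x : ℝ) : Summable fun k : ℤ => ‖g (x - α * k)‖ := by
  obtain ⟨J, hJ⟩ := exists_nat_ge (|x| / α)
  rw [div_le_iff₀ hα] at hJ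
  obtain ⟨u, hu, hle⟩ := hW J
  exact Summable.of_nonneg_of_le (fun _ => norm_nonneg _) (hle x (by linarith)) hu

/-- The Zak transform in the normalised frequency variable `θ = α ξ`. -/
noncomputable def unitZak (g : ℝ → ℂ) (α x θ : ℝ) : ℂ :=
  ∑' k : ℤ, g (x - α * k) * expTwoPiI (k * θ)

lemma zak_eq_unitZak (g : ℝ → ℂ) (α x ξ : ℝ) : zak g α x ξ = unitZak g α x (α * ξ) := by
  refine tsum_congr fun k => ?_
  rw [expTwoPiI]
  congr 3
  push_cast
  ring

lemma unitZak_add_int (g : ℝ → ℂ) (α x θ : ℝ) (n : ℤ) :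
    unitZak g α x (θ + n) = unitZak g α x θ := by
  refine tsum_congr fun k => ?_
  rw [mul_add, ← Int.cast_mul, expTwoPiI_add_int]

lemma unitZak_add_mul_int (g : ℝ → ℂ) (α x θ : ℝ) (m : ℤ) :
    unitZak g α (x + α * m) θ = expTwoPiI (m * θ) * unitZak g α x θ := by
  rw [unitZak, unitZak, ← tsum_mul_left, ← (Equiv.addRight m).tsum_eq]
  refine tsum_congr fun k => ?_
  rw [Equiv.coe_addRight, mul_left_comm, ← expTwoPiI_add]
  congr 2 <;> push_cast <;> ring

lemma continuous_unitZak {g : ℝ → ℂ} (hg : Continuous g) {α : ℝ} (hα : 0 < α)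
    (hW : TranslatesDominated g α) :
    Continuous fun z : ℝ × ℝ => unitZak g α z.1 z.2 := by
  rw [continuous_iff_continuousAt]
  intro z
  obtain ⟨J, hJ⟩ := exists_nat_gt (|z.1| / α)
  rw [div_lt_iff₀ hα] at hJ
  obtain ⟨u, hu, hle⟩ := hW J
  have hopen : IsOpen {w : ℝ × ℝ | |w.1| < α * J} := isOpen_lt (by fun_prop) (by fun_prop)
  refine ContinuousOn.continuousAt (s := {w : ℝ × ℝ | |w.1| < α * J}) ?_
    (hopen.mem_nhds (by simpa [mul_comm] using hJ))
  refine continuousOn_tsum (u := u) (fun k => ?_) hu fun k w hw => ?_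
  · exact ((hg.comp (by fun_prop)).mul (continuous_expTwoPiI.comp (by fun_prop))).continuousOn
  · rw [norm_mul, norm_expTwoPiI, mul_one]
    exact hle w.1 (le_of_lt hw) k

/-- The Fourier series with coefficients `conj (a (m p + s))`, `m ∈ ℤ`. -/
noncomputable def residueSeries (p : ℕ) (a : ℤ → ℂ) (s : Fin p) (τ : ℝ) : ℂ :=
  ∑' m : ℤ, (starRingEnd ℂ) (a (m * p + (s : ℕ))) * expTwoPiI (m * τ)

lemma injective_mul_add {p : ℕ} (hp : 0 < p) (s : Fin p) :
    Function.Injective fun m : ℤ => m * p + (s : ℕ) := by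
  intro m n h
  simpa [hp.ne'] using h

lemma tsum_int_eq_sum_tsum_residue {E : Type*} [NormedAddCommGroup E] [CompleteSpace E] {p : ℕ}
    (hp : 0 < p) {F : ℤ → E} (hF : Summable F) :
    ∑' n, F n = ∑ s : Fin p, ∑' m : ℤ, F (m * p + (s : ℕ)) := by
  have : NeZero p := ⟨hp.ne'⟩
  rw [← (Int.divModEquiv p).symm.tsum_eq,
    Summable.tsum_prod' (f := fun z => F ((Int.divModEquiv p).symm z))
      ((Int.divModEquiv p).symm.summable_iff.mpr hF) fun b => (hasSum_fintype _).summable]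
  simp only [tsum_fintype, Int.divModEquiv_symm_apply]
  exact Summable.tsum_finsetSum fun s _ => hF.comp_injective (injective_mul_add hp s)

lemma summable_residue {p : ℕ} (hp : 0 < p) {a : ℤ → ℂ} {S : Finset ℤ} (ha : ∀ n ∉ S, a n = 0)
    (s : Fin p) : Summable fun m : ℤ => ‖(starRingEnd ℂ) (a (m * p + (s : ℕ)))‖ := by
  have h : Summable fun n => ‖a n‖ :=
    summable_of_ne_finset_zero (s := S) fun n hn => by rw [ha n hn, norm_zero]
  simpa [Function.comp_def] using h.comp_injective (injective_mul_add hp s)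

lemma continuous_residueSeries {p : ℕ} (hp : 0 < p) {a : ℤ → ℂ} {S : Finset ℤ}
    (ha : ∀ n ∉ S, a n = 0) (s : Fin p) : Continuous (residueSeries p a s) := by
  refine continuous_tsum (fun m => ?_) (summable_residue hp ha s) fun m τ => ?_
  · exact continuous_const.mul (continuous_expTwoPiI.comp (by fun_prop))
  · rw [norm_mul, norm_expTwoPiI, mul_one]

/-- The squared `ℓ²` norm of a finitely supported sequence in terms of its residue series. -/
lemma tsum_sq_norm_eq_integral {p : ℕ} (hp : 0 < p) {a : ℤ → ℂ} {S : Finset ℤ}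
    (ha : ∀ n ∉ S, a n = 0) :
    ∑' n, ‖a n‖ ^ 2 = ∫ τ in (0 : ℝ)..1, ∑ s : Fin p, ‖residueSeries p a s τ‖ ^ 2 := by
  rw [tsum_int_eq_sum_tsum_residue hp
    (summable_of_ne_finset_zero (s := S) fun n hn => by rw [ha n hn, norm_zero, sq, mul_zero]),
    intervalIntegral.integral_finsetSum fun s _ => Continuous.intervalIntegrable
      (by have := continuous_residueSeries hp ha s; fun_prop) _ _]
  refine Finset.sum_congr rfl fun s _ => ?_
  have h := (hasSum_sq_of_summable (summable_residue hp ha s)).tsum_eq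
  simpa [residueSeries] using h

/-- The Zak transforms occurring in the fibre of the Gabor frame operator, applied to `v`. -/
noncomputable def zakForm (g : ℝ → ℂ) (α δ : ℝ) (p q : ℕ) (v : Fin p → ℂ) (x τ : ℝ) : ℝ :=
  ∑ j : Fin q, ‖∑ s : Fin p, v s * unitZak g α (x + (s : ℕ) * δ) ((τ + (j : ℕ)) / q)‖ ^ 2

lemma tsum_conj_mul_unitZak_eq {g : ℝ → ℂ} {α δ : ℝ} {p q : ℕ} (hp : 0 < p) (hq : 0 < q)
    (hδ : p * δ = q * α) {a : ℤ → ℂ} {S : Finset ℤ} (ha : ∀ n ∉ S, a n = 0) (x τ : ℝ) (j : ℕ) :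
    ∑ n ∈ S, (starRingEnd ℂ) (a n) * unitZak g α (x + n * δ) ((τ + j) / q) =
      ∑ s : Fin p, residueSeries p a s τ * unitZak g α (x + (s : ℕ) * δ) ((τ + j) / q) := by
  have h0 : ∀ n ∉ S, (starRingEnd ℂ) (a n) * unitZak g α (x + n * δ) ((τ + j) / q) = 0 :=
    fun n hn => by rw [ha n hn, map_zero, zero_mul]
  rw [← (hasSum_sum_of_ne_finset_zero (L := .unconditional ℤ) h0).tsum_eq,
    tsum_int_eq_sum_tsum_residue hp (summable_of_ne_finset_zero (s := S) h0)]
  refine Finset.sum_congr rfl fun s _ => ?_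
  rw [residueSeries, ← tsum_mul_right]
  refine tsum_congr fun m => ?_
  have hq' : (q : ℝ) ≠ 0 := by positivity
  have e1 : x + ((m * p + (s : ℕ) : ℤ) : ℝ) * δ = x + (s : ℕ) * δ + α * ((q * m : ℤ) : ℝ) := by
    push_cast
    linear_combination (m : ℝ) * hδ
  have e2 : ((q * m : ℤ) : ℝ) * ((τ + j) / q) = m * τ + ((m * j : ℤ) : ℝ) := by
    push_cast
    field_simp
  rw [e1, unitZak_add_mul_int, e2, expTwoPiI_add_int, mul_assoc]

/-- The fibre of the Gabor frame operator as an integral of Zak transforms. -/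
lemma hasSum_fiber {g : ℝ → ℂ} (hg : Continuous g) {α δ : ℝ} (hα : 0 < α)
    (hW : TranslatesDominated g α) {p q : ℕ} (hp : 0 < p) (hq : 0 < q) (hδ : p * δ = q * α)
    {a : ℤ → ℂ} {S : Finset ℤ} (ha : ∀ n ∉ S, a n = 0) (x : ℝ) :
    HasSum (fun k : ℤ => ‖∑ n ∈ S, a n * (starRingEnd ℂ) (g (x + n * δ - α * k))‖ ^ 2)
      ((q : ℝ)⁻¹ * ∫ τ in (0 : ℝ)..1,
        zakForm g α δ p q (fun s => residueSeries p a s τ) x τ) := by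
  set b : ℤ → ℂ := fun k => ∑ n ∈ S, (starRingEnd ℂ) (a n) * g (x + n * δ - α * k) with hb
  have hbs : Summable fun k => ‖b k‖ := by
    refine Summable.of_nonneg_of_le (fun _ => norm_nonneg _) (fun k => norm_sum_le _ _)
      (summable_sum fun n _ => ?_)
    simp only [norm_mul]
    exact (hW.summable_norm hα (x + n * δ)).mul_left _
  have hbk : ∀ k, ‖b k‖ = ‖∑ n ∈ S, a n * (starRingEnd ℂ) (g (x + n * δ - α * k))‖ := by
    intro k
    rw [← Complex.norm_conj, hb]
    simp
  have hZ : ∀ t, ∑' k, b k * expTwoPiI (k * t) =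
      ∑ n ∈ S, (starRingEnd ℂ) (a n) * unitZak g α (x + n * δ) t := by
    intro t
    simp only [hb, Finset.sum_mul, unitZak, ← tsum_mul_left, mul_assoc]
    refine Summable.tsum_finsetSum fun n _ => Summable.mul_left _ (Summable.of_norm ?_)
    simpa [norm_expTwoPiI] using hW.summable_norm hα (x + n * δ)
  have hcont : Continuous fun t =>
      ‖∑ n ∈ S, (starRingEnd ℂ) (a n) * unitZak g α (x + n * δ) t‖ ^ 2 := by
    refine (Continuous.norm ?_).pow 2
    refine continuous_finsetSum _ fun n _ => continuous_const.mul ?_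
    exact (continuous_unitZak hg hα hW).comp (by fun_prop : Continuous fun t => (x + n * δ, t))
  have h := hasSum_sq_of_summable hbs
  simp only [hbk, hZ] at h
  rw [integral_eq_sum_integral_div hcont hq] at h
  simp only [tsum_conj_mul_unitZak_eq hp hq hδ ha] at h
  exact h

lemma continuous_zakForm {g : ℝ → ℂ} (hg : Continuous g) {α δ : ℝ} (hα : 0 < α)
    (hW : TranslatesDominated g α) (p q : ℕ) :
    Continuous fun z : (Fin p → ℂ) × ℝ × ℝ => zakForm g α δ p q z.1 z.2.1 z.2.2 := by
  refine continuous_finsetSum _ fun j _ => (Continuous.norm ?_).pow 2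
  refine continuous_finsetSum _ fun s _ => Continuous.mul (by fun_prop) ?_
  exact (continuous_unitZak hg hα hW).comp (by fun_prop : Continuous fun z :
    (Fin p → ℂ) × ℝ × ℝ => (z.2.1 + (s : ℕ) * δ, (z.2.2 + (j : ℕ)) / (q : ℝ)))

lemma zakForm_add_one (g : ℝ → ℂ) (α δ : ℝ) (p : ℕ) {q : ℕ} (hq : 0 < q) (v : Fin p → ℂ)
    (x τ : ℝ) : zakForm g α δ p q v x (τ + 1) = zakForm g α δ p q v x τ := by
  set G : ℕ → ℝ := fun j =>
    ‖∑ s : Fin p, v s * unitZak g α (x + (s : ℕ) * δ) ((τ + (j : ℕ)) / q)‖ ^ 2 with hG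
  have hq' : (q : ℝ) ≠ 0 := by positivity
  have h1 : zakForm g α δ p q v x (τ + 1) = ∑ j ∈ Finset.range q, G (j + 1) := by
    rw [← Fin.sum_univ_eq_sum_range (fun j => G (j + 1))]
    refine Finset.sum_congr rfl fun j _ => ?_
    simp only [hG]
    push_cast
    rw [add_assoc, add_comm (1 : ℝ)]
  have h2 : zakForm g α δ p q v x τ = ∑ j ∈ Finset.range q, G j := by
    rw [← Fin.sum_univ_eq_sum_range G]
    rfl
  have h3 : G q = G 0 := by
    simp only [hG]
    have : (τ + (q : ℕ)) / (q : ℝ) = (τ + (0 : ℕ)) / q + ((1 : ℤ) : ℝ) := by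
      push_cast
      field_simp
      ring
    simp only [this, unitZak_add_int]
  have h4 := Finset.sum_range_succ G q
  rw [Finset.sum_range_succ'] at h4
  rw [h1, h2]
  linarith

lemma continuous_zakForm_comp {X : Type*} [TopologicalSpace X] {g : ℝ → ℂ} (hg : Continuous g)
    {α : ℝ} (hα : 0 < α) (hW : TranslatesDominated g α) (δ : ℝ) {p : ℕ} (q : ℕ)
    {V : X → Fin p → ℂ} {y t : X → ℝ} (hV : Continuous V) (hy : Continuous y)
    (ht : Continuous t) : Continuous fun z => zakForm g α δ p q (V z) (y z) (t z) :=
  Continuous.comp (g := fun z : (Fin p → ℂ) × ℝ × ℝ => zakForm g α δ p q z.1 z.2.1 z.2.2)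
    (f := fun z => (V z, y z, t z)) (continuous_zakForm hg hα hW p q)
    (hV.prodMk (hy.prodMk ht))

lemma zakForm_mul (g : ℝ → ℂ) (α δ : ℝ) (p q : ℕ) (v : Fin p → ℂ) (c : ℂ) (x τ : ℝ) :
    zakForm g α δ p q (fun s => v s * c) x τ = ‖c‖ ^ 2 * zakForm g α δ p q v x τ := by
  rw [zakForm, zakForm, Finset.mul_sum]
  refine Finset.sum_congr rfl fun j _ => ?_
  rw [← mul_pow, ← norm_mul, Finset.mul_sum]
  congr 2
  exact Finset.sum_congr rfl fun s _ => by ring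

lemma zakForm_nonneg (g : ℝ → ℂ) (α δ : ℝ) (p q : ℕ) (v : Fin p → ℂ) (x τ : ℝ) :
    0 ≤ zakForm g α δ p q v x τ :=
  Finset.sum_nonneg fun _ _ => by positivity

lemma sum_sq_norm_le {p : ℕ} (v : Fin p → ℂ) : ∑ s, ‖v s‖ ^ 2 ≤ p * ‖v‖ ^ 2 := by
  calc ∑ s, ‖v s‖ ^ 2 ≤ ∑ _s : Fin p, ‖v‖ ^ 2 :=
        Finset.sum_le_sum fun s _ => by gcongr; exact norm_le_pi_norm v s
    _ = p * ‖v‖ ^ 2 := by simp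

lemma sq_norm_le_sum {p : ℕ} (v : Fin p → ℂ) : ‖v‖ ^ 2 ≤ ∑ s, ‖v s‖ ^ 2 := by
  rw [← Real.le_sqrt (norm_nonneg v) (Finset.sum_nonneg fun _ _ => by positivity)]
  refine (pi_norm_le_iff_of_nonneg (Real.sqrt_nonneg _)).mpr fun s => ?_
  refine Real.le_sqrt_of_sq_le ?_
  exact Finset.single_le_sum (f := fun s => ‖v s‖ ^ 2) (fun _ _ => by positivity)
    (Finset.mem_univ s)

lemma exists_sphere_eq_mul {p : ℕ} {v : Fin p → ℂ} (hv : v ≠ 0) :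
    ∃ w ∈ Metric.sphere (0 : Fin p → ℂ) 1, v = fun s => w s * (‖v‖ : ℂ) := by
  have hv0 : (‖v‖ : ℂ) ≠ 0 := by simpa using hv
  refine ⟨fun s => (‖v‖ : ℂ)⁻¹ * v s, ?_, ?_⟩
  · have : (fun s => (‖v‖ : ℂ)⁻¹ * v s) = (‖v‖ : ℂ)⁻¹ • v := rfl
    rw [mem_sphere_zero_iff_norm, this, norm_smul]
    simp [hv]
  · ext s
    field_simp

lemma zakForm_zero (g : ℝ → ℂ) (α δ : ℝ) (p q : ℕ) (x τ : ℝ) :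
    zakForm g α δ p q 0 x τ = 0 := by
  simp [zakForm]

lemma isCompact_zakDomain (p : ℕ) (δ : ℝ) :
    IsCompact (Metric.sphere (0 : Fin p → ℂ) 1 ×ˢ Set.Icc (0 : ℝ) δ ×ˢ Set.Icc (0 : ℝ) 1) :=
  (isCompact_sphere _ _).prod (isCompact_Icc.prod isCompact_Icc)

lemma exists_zakForm_le {g : ℝ → ℂ} (hg : Continuous g) {α δ : ℝ} (hα : 0 < α)
    (hW : TranslatesDominated g α) (p q : ℕ) :
    ∃ C > 0, ∀ x ∈ Set.Icc (0 : ℝ) δ, ∀ τ ∈ Set.Icc (0 : ℝ) 1, ∀ v : Fin p → ℂ,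
      zakForm g α δ p q v x τ ≤ C * ∑ s, ‖v s‖ ^ 2 := by
  obtain ⟨C, hC⟩ := (isCompact_zakDomain p δ).bddAbove_image
    (continuous_zakForm hg hα hW (δ := δ) p q).continuousOn
  refine ⟨max C 1, by positivity, fun x hx τ hτ v => ?_⟩
  rcases eq_or_ne v 0 with rfl | hv
  · simp [zakForm_zero]
  obtain ⟨w, hw, hvw⟩ := exists_sphere_eq_mul hv
  have h1 := hC (Set.mem_image_of_mem _ (show (w, x, τ) ∈ _ from ⟨hw, hx, hτ⟩))
  calc zakForm g α δ p q v x τ = ‖v‖ ^ 2 * zakForm g α δ p q w x τ := by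
        conv_lhs => rw [hvw]
        rw [zakForm_mul]
        simp
    _ ≤ ‖v‖ ^ 2 * max C 1 := by gcongr; exact h1.trans (le_max_left _ _)
    _ ≤ (∑ s, ‖v s‖ ^ 2) * max C 1 := by gcongr; exact sq_norm_le_sum v
    _ = _ := mul_comm _ _

lemma exists_le_zakForm {g : ℝ → ℂ} (hg : Continuous g) {α δ : ℝ} (hα : 0 < α)
    (hW : TranslatesDominated g α) {p : ℕ} (hp : 0 < p) (q : ℕ)
    (hnd : ∀ x τ v, zakForm g α δ p q v x τ = 0 → v = 0) :
    ∃ c > 0, ∀ x ∈ Set.Icc (0 : ℝ) δ, ∀ τ ∈ Set.Icc (0 : ℝ) 1, ∀ v : Fin p → ℂ,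
      c * ∑ s, ‖v s‖ ^ 2 ≤ zakForm g α δ p q v x τ := by
  obtain ⟨c, hc0, hc⟩ := (isCompact_zakDomain p δ).exists_forall_le'
    (continuous_zakForm hg hα hW (δ := δ) p q).continuousOn (a := 0) fun z hz =>
      lt_of_le_of_ne (zakForm_nonneg _ _ _ _ _ _ _ _) fun h => by
        have := hnd _ _ _ h.symm
        have hz1 := hz.1
        rw [this] at hz1
        simp at hz1
  refine ⟨c / p, by positivity, fun x hx τ hτ v => ?_⟩
  rcases eq_or_ne v 0 with rfl | hv
  · simp [zakForm_zero]
  obtain ⟨w, hw, hvw⟩ := exists_sphere_eq_mul hv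
  have h1 := hc (w, x, τ) ⟨hw, hx, hτ⟩
  calc c / p * ∑ s, ‖v s‖ ^ 2 ≤ c / p * (p * ‖v‖ ^ 2) := by gcongr; exact sum_sq_norm_le v
    _ = ‖v‖ ^ 2 * c := by field_simp
    _ ≤ ‖v‖ ^ 2 * zakForm g α δ p q w x τ := by gcongr
    _ = zakForm g α δ p q v x τ := by
        conv_rhs => rw [hvw]
        rw [zakForm_mul]
        simp

/-- A continuous function on the circle is nonnegative if its integral against the squared
modulus of every trigonometric polynomial is. -/
lemma nonneg_of_forall_trigPoly (D : C(UnitAddCircle, ℝ))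
    (hD : ∀ h ∈ Submodule.span ℂ (Set.range (@fourier (1 : ℝ))),
      0 ≤ ∫ t, ‖h t‖ ^ 2 * D t ∂(AddCircle.haarAddCircle (T := (1 : ℝ)))) (t : UnitAddCircle) :
    0 ≤ D t := by
  let P : C(UnitAddCircle, ℂ) → C(UnitAddCircle, ℝ) := fun h =>
    (ContinuousMap.comp ⟨fun z : ℂ => ‖z‖ ^ 2, by fun_prop⟩ h) * D
  have hPc : Continuous P := by
    refine Continuous.mul ?_ continuous_const
    exact ContinuousMap.continuous_postcomp _
  have hΨ : Continuous fun h : C(UnitAddCircle, ℂ) =>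
      ∫ t, ‖h t‖ ^ 2 * D t ∂(AddCircle.haarAddCircle (T := (1 : ℝ))) := by
    have h1 : ∀ h : C(UnitAddCircle, ℂ),
        ∫ t, ‖h t‖ ^ 2 * D t ∂(AddCircle.haarAddCircle (T := (1 : ℝ))) =
        ∫ t, (ContinuousMap.toLp (E := ℝ) 1 (AddCircle.haarAddCircle (T := (1 : ℝ))) ℝ (P h)) t
          ∂(AddCircle.haarAddCircle (T := (1 : ℝ))) := by
      intro h
      refine integral_congr_ae ?_
      filter_upwards [ContinuousMap.coeFn_toLp (p := 1) (𝕜 := ℝ)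
        (AddCircle.haarAddCircle (T := (1 : ℝ))) (P h)] with t ht
      rw [ht]
      rfl
    simp only [h1]
    exact continuous_integral.comp ((ContinuousLinearMap.continuous _).comp hPc)
  have hall : ∀ h : C(UnitAddCircle, ℂ),
      0 ≤ ∫ t, ‖h t‖ ^ 2 * D t ∂(AddCircle.haarAddCircle (T := (1 : ℝ))) := by
    intro h
    have hcl : IsClosed {h : C(UnitAddCircle, ℂ) |
        0 ≤ ∫ t, ‖h t‖ ^ 2 * D t ∂(AddCircle.haarAddCircle (T := (1 : ℝ)))} :=
      isClosed_le continuous_const hΨ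
    have hmem : h ∈ (Submodule.span ℂ (Set.range (@fourier (1 : ℝ)))).topologicalClosure := by
      rw [span_fourier_closure_eq_top]
      trivial
    exact closure_minimal (fun h hh => hD h hh) hcl hmem
  by_contra! hneg
  let h : C(UnitAddCircle, ℂ) := ⟨fun t => ((max 0 (-D t) : ℝ) : ℂ), by fun_prop⟩
  have h1 := hall h
  have h2 : ∀ t, ‖h t‖ ^ 2 * D t = -(max 0 (-D t)) ^ 3 := by
    intro t
    have : ‖h t‖ = max 0 (-D t) := by
      change ‖((max 0 (-D t) : ℝ) : ℂ)‖ = _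
      rw [Complex.norm_real, Real.norm_of_nonneg (le_max_left _ _)]
    rw [this]
    rcases le_total 0 (-D t) with ht | ht
    · rw [max_eq_right ht]; ring
    · rw [max_eq_left ht]; ring
  simp only [h2, integral_neg] at h1
  have h3 : 0 < ∫ t, (max 0 (-D t)) ^ 3 ∂(AddCircle.haarAddCircle (T := (1 : ℝ))) := by
    refine Continuous.integral_pos_of_hasCompactSupport_nonneg_nonzero (x := t) (by fun_prop)
      (HasCompactSupport.of_compactSpace _) (fun t => ?_) ?_
    · exact pow_nonneg (le_max_left _ _) 3
    · rw [max_eq_right (by linarith)]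
      exact pow_ne_zero 3 (by linarith)
  linarith

lemma exists_seq_residueSeries_eq {p : ℕ} (hp : 0 < p) (v : Fin p → ℂ) {h : C(UnitAddCircle, ℂ)}
    (hh : h ∈ Submodule.span ℂ (Set.range (@fourier (1 : ℝ)))) :
    ∃ (a : ℤ → ℂ) (S : Finset ℤ), (∀ n ∉ S, a n = 0) ∧
      ∀ s (τ : ℝ), residueSeries p a s τ = v s * h (τ : UnitAddCircle) := by
  have : NeZero p := ⟨hp.ne'⟩
  obtain ⟨c, rfl⟩ := Finsupp.mem_span_range_iff_exists_finsupp.mp hh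
  refine ⟨fun n => (starRingEnd ℂ) (v (Int.divModEquiv p n).2 * c (Int.divModEquiv p n).1),
    (c.support ×ˢ Finset.univ).map (Int.divModEquiv p).symm.toEmbedding, fun n hn => ?_,
    fun s τ => ?_⟩
  · have : (Int.divModEquiv p n).1 ∉ c.support := by
      intro hc
      refine hn (Finset.mem_map.mpr ⟨Int.divModEquiv p n, ?_, ?_⟩)
      · simpa using hc
      · exact Equiv.symm_apply_apply _ _
    simp only [Finsupp.notMem_support_iff.mp this, mul_zero, map_zero]
  · have h1 : ∀ m : ℤ, Int.divModEquiv p (m * p + (s : ℕ)) = (m, s) := by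
      intro m
      rw [← Int.divModEquiv_symm_apply p (m, s), Equiv.apply_symm_apply]
    simp only [residueSeries, h1, Complex.conj_conj]
    rw [tsum_eq_sum (s := c.support)]
    · simp only [Finsupp.sum, Finset.mul_sum, ContinuousMap.sum_apply, ContinuousMap.smul_apply,
        fourier_unit_coe, smul_eq_mul, mul_assoc]
    · intro m hm
      simp [Finsupp.notMem_support_iff.mp hm]

lemma intervalIntegral_zakForm_le {g : ℝ → ℂ} (hg : Continuous g) {α δ : ℝ} (hα : 0 < α)
    (hW : TranslatesDominated g α) {p q : ℕ} (hp : 0 < p) {C : ℝ} {x : ℝ}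
    (hC : ∀ τ ∈ Set.Icc (0 : ℝ) 1, ∀ v : Fin p → ℂ,
      zakForm g α δ p q v x τ ≤ C * ∑ s, ‖v s‖ ^ 2)
    {a : ℤ → ℂ} {S : Finset ℤ} (ha : ∀ n ∉ S, a n = 0) :
    ∫ τ in (0 : ℝ)..1, zakForm g α δ p q (fun s => residueSeries p a s τ) x τ ≤
      C * ∑' n, ‖a n‖ ^ 2 := by
  have hc := fun s => continuous_residueSeries hp ha s
  rw [tsum_sq_norm_eq_integral hp ha, ← intervalIntegral.integral_const_mul]
  refine intervalIntegral.integral_mono_on zero_le_one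
    (Continuous.intervalIntegrable ?_ _ _) (Continuous.intervalIntegrable (by fun_prop) _ _)
    fun τ hτ => hC τ hτ _
  exact continuous_zakForm_comp hg hα hW δ q (continuous_pi hc) continuous_const continuous_id

lemma le_intervalIntegral_zakForm {g : ℝ → ℂ} (hg : Continuous g) {α δ : ℝ} (hα : 0 < α)
    (hW : TranslatesDominated g α) {p q : ℕ} (hp : 0 < p) {c : ℝ} {x : ℝ}
    (hc : ∀ τ ∈ Set.Icc (0 : ℝ) 1, ∀ v : Fin p → ℂ,
      c * ∑ s, ‖v s‖ ^ 2 ≤ zakForm g α δ p q v x τ)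
    {a : ℤ → ℂ} {S : Finset ℤ} (ha : ∀ n ∉ S, a n = 0) :
    c * ∑' n, ‖a n‖ ^ 2 ≤
      ∫ τ in (0 : ℝ)..1, zakForm g α δ p q (fun s => residueSeries p a s τ) x τ := by
  have hc' := fun s => continuous_residueSeries hp ha s
  rw [tsum_sq_norm_eq_integral hp ha, ← intervalIntegral.integral_const_mul]
  refine intervalIntegral.integral_mono_on zero_le_one
    (Continuous.intervalIntegrable (by fun_prop) _ _) (Continuous.intervalIntegrable ?_ _ _)
    fun τ hτ => hc τ hτ _
  exact continuous_zakForm_comp hg hα hW δ q (continuous_pi hc') continuous_const continuous_id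

/-- A lower bound for the fibre on finitely supported sequences is inherited by the symbol. -/
lemma le_zakForm_of_forall_seq {g : ℝ → ℂ} (hg : Continuous g) {α δ : ℝ} (hα : 0 < α)
    (hW : TranslatesDominated g α) {p q : ℕ} (hp : 0 < p) (hq : 0 < q) {c : ℝ} {x : ℝ}
    (hc : ∀ (a : ℤ → ℂ) (S : Finset ℤ), (∀ n ∉ S, a n = 0) → c * ∑' n, ‖a n‖ ^ 2 ≤
      ∫ τ in (0 : ℝ)..1, zakForm g α δ p q (fun s => residueSeries p a s τ) x τ)
    (v : Fin p → ℂ) (τ : ℝ) :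
    c * ∑ s, ‖v s‖ ^ 2 ≤ zakForm g α δ p q v x τ := by
  have hzc : Continuous fun τ => zakForm g α δ p q v x τ :=
    continuous_zakForm_comp hg hα hW δ q continuous_const continuous_const continuous_id
  have hper : Function.Periodic (fun τ => zakForm g α δ p q v x τ - c * ∑ s, ‖v s‖ ^ 2) 1 :=
    fun τ => by simp only [zakForm_add_one g α δ p hq v x τ]
  let D : C(UnitAddCircle, ℝ) := ⟨hper.lift,
    continuous_coinduced_dom.mpr (hzc.sub continuous_const)⟩
  have hDt : ∀ τ : ℝ, D (τ : UnitAddCircle) = zakForm g α δ p q v x τ - c * ∑ s, ‖v s‖ ^ 2 :=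
    fun τ => rfl
  have key := nonneg_of_forall_trigPoly D (fun h hh => ?_) (τ : UnitAddCircle)
  · rw [hDt] at key
    linarith
  obtain ⟨a, S, ha, hres⟩ := exists_seq_residueSeries_eq hp v hh
  have h1 := hc a S ha
  rw [tsum_sq_norm_eq_integral hp ha] at h1
  simp only [hres, zakForm_mul] at h1
  have h5 := AddCircle.intervalIntegral_preimage (1 : ℝ) 0 (fun t => ‖h t‖ ^ 2 * D t)
  rw [AddCircle.integral_haarAddCircle, ← h5]
  have hhc : Continuous fun τ : ℝ => h (τ : UnitAddCircle) :=
    h.continuous.comp (AddCircle.continuous_mk' _)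
  have h6 : ∀ τ : ℝ, ‖h (τ : UnitAddCircle)‖ ^ 2 * D (τ : UnitAddCircle) =
      ‖h (τ : UnitAddCircle)‖ ^ 2 * zakForm g α δ p q v x τ -
      c * ∑ s, ‖v s * h (τ : UnitAddCircle)‖ ^ 2 := by
    intro τ
    simp only [hDt, norm_mul, mul_pow, ← Finset.sum_mul]
    ring
  simp only [h6, zero_add]
  rw [intervalIntegral.integral_sub (Continuous.intervalIntegrable (by fun_prop) _ _)
    (Continuous.intervalIntegrable (by fun_prop) _ _), intervalIntegral.integral_const_mul]
  simpa using h1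

/-- The part of the `δ`-periodic fibre of `f` over `yδ` indexed by `S`. -/
noncomputable def fiberSeq (f : ℝ → ℂ) (δ : ℝ) (S : Finset ℤ) (y : ℝ) (n : ℤ) : ℂ :=
  if n ∈ S then f ((y + n) * δ) else 0

lemma fiberSeq_eq_zero (f : ℝ → ℂ) (δ : ℝ) (S : Finset ℤ) (y : ℝ) :
    ∀ n ∉ S, fiberSeq f δ S y n = 0 := fun _ hn => if_neg hn

lemma continuous_fiberSeq {f : ℝ → ℂ} (hf : Continuous f) (δ : ℝ) (S : Finset ℤ) (n : ℤ) :
    Continuous fun y => fiberSeq f δ S y n := by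
  unfold fiberSeq
  split_ifs <;> fun_prop

lemma tsum_sq_fiberSeq (f : ℝ → ℂ) (δ : ℝ) (S : Finset ℤ) (y : ℝ) :
    ∑' n, ‖fiberSeq f δ S y n‖ ^ 2 = ∑ n ∈ S, ‖f ((y + n) * δ)‖ ^ 2 := by
  rw [tsum_eq_sum (s := S) fun n hn => by rw [fiberSeq_eq_zero f δ S y n hn]; simp]
  exact Finset.sum_congr rfl fun n hn => by rw [fiberSeq, if_pos hn]

lemma continuous_residueSeries_comp {X : Type*} [TopologicalSpace X] {p : ℕ} (hp : 0 < p)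
    {b : X → ℤ → ℂ} {S : Finset ℤ} (hb : ∀ n, Continuous fun x => b x n)
    (hS : ∀ x, ∀ n ∉ S, b x n = 0) {t : X → ℝ} (ht : Continuous t) (s : Fin p) :
    Continuous fun x => residueSeries p (b x) s (t x) := by
  have h : ∀ x, residueSeries p (b x) s (t x) =
      ∑ m ∈ S.preimage (fun m : ℤ => m * p + (s : ℕ)) (injective_mul_add hp s).injOn,
        (starRingEnd ℂ) (b x (m * p + (s : ℕ))) * expTwoPiI (m * t x) := by
    intro x
    refine tsum_eq_sum fun m hm => ?_
    rw [hS x _ (by simpa using hm), map_zero, zero_mul]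
  simp only [h]
  refine continuous_finsetSum _ fun m _ => ?_
  exact (Complex.continuous_conj.comp (hb _)).mul (continuous_expTwoPiI.comp (by fun_prop))

lemma exists_finset_shift {f : ℝ → ℂ} (hf : HasCompactSupport f) {δ : ℝ} (hδ : 0 < δ) (a : ℝ) :
    ∃ S : Finset ℤ, ∀ y ∈ Set.Icc a (a + 1), ∀ n ∉ S, f ((y + (n : ℤ)) * δ) = 0 := by
  obtain ⟨R, hR⟩ := hf.isBounded.subset_closedBall (0 : ℝ)
  refine ⟨Finset.Icc ⌊-R / δ - a - 1⌋ ⌈R / δ - a⌉, fun y hy n hn => ?_⟩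
  by_contra h0
  have h1 := hR (subset_tsupport f h0)
  rw [Metric.mem_closedBall, dist_zero_right, Real.norm_eq_abs, abs_le] at h1
  apply hn
  have h2 : y + n ≤ R / δ := by rw [le_div_iff₀ hδ]; exact h1.2
  have h3 : -R / δ ≤ y + n := by rw [div_le_iff₀ hδ]; exact h1.1
  rw [Finset.mem_Icc]
  constructor
  · have : (⌊-R / δ - a - 1⌋ : ℝ) ≤ n := (Int.floor_le _).trans (by linarith [hy.2])
    exact_mod_cast this
  · have : (n : ℝ) ≤ ⌈R / δ - a⌉ := le_trans (by linarith [hy.1]) (Int.le_ceil _)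
    exact_mod_cast this

lemma integral_eq_intervalIntegral_sum {E : Type*} [NormedAddCommGroup E] [NormedSpace ℝ E]
    [CompleteSpace E] {u : ℝ → E} (hu : Continuous u) (hi : Integrable u) {a : ℝ} {S : Finset ℤ}
    (hS : ∀ y ∈ Set.Icc a (a + 1), ∀ n ∉ S, u (y + (n : ℤ)) = 0) :
    ∫ y, u y = ∫ y in a..(a + 1), ∑ n ∈ S, u (y + n) := by
  have h := hi.hasSum_intervalIntegral a
  have h1 : ∀ n : ℤ, ∫ x in a + n..a + n + 1, u x = ∫ y in a..(a + 1), u (y + n) := by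
    intro n
    rw [intervalIntegral.integral_comp_add_right]
    congr 1
    ring
  simp only [h1] at h
  have h2 : ∀ n ∉ S, ∫ y in a..(a + 1), u (y + n) = 0 := by
    intro n hn
    rw [intervalIntegral.integral_congr (g := fun _ => 0) (fun y hy => ?_)]
    · simp
    · rw [Set.uIcc_of_le (by linarith)] at hy
      exact hS y hy n hn
  rw [intervalIntegral.integral_finsetSum fun n _ =>
    (Continuous.intervalIntegrable (by fun_prop) _ _)]
  exact h.unique (hasSum_sum_of_ne_finset_zero h2)

lemma integral_sq_eq_fiber {f : ℝ → ℂ} (hf : Continuous f) (hfc : HasCompactSupport f) {δ : ℝ}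
    (hδ : 0 < δ) {a : ℝ} {S : Finset ℤ}
    (hS : ∀ y ∈ Set.Icc a (a + 1), ∀ n ∉ S, f ((y + (n : ℤ)) * δ) = 0) :
    ∫ x, ‖f x‖ ^ 2 = δ * ∫ y in a..(a + 1), ∑' n, ‖fiberSeq f δ S y n‖ ^ 2 := by
  have hi : Integrable fun x => ‖f x‖ ^ 2 := by
    refine Continuous.integrable_of_hasCompactSupport (by fun_prop) ?_
    exact hfc.comp_left (g := fun z : ℂ => ‖z‖ ^ 2) (by simp)
  have h := integral_eq_intervalIntegral_sum (u := fun y => ‖f (y * δ)‖ ^ 2) (by fun_prop)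
    (hi.comp_mul_right' hδ.ne') (a := a) (S := S)
    (fun y hy n hn => by simp only [hS y hy n hn]; simp)
  rw [Measure.integral_comp_mul_right (fun x => ‖f x‖ ^ 2) δ] at h
  simp only [tsum_sq_fiberSeq]
  rw [← h, abs_of_pos (by positivity), smul_eq_mul, mul_inv_cancel_left₀ hδ.ne']

/-- The Gabor coefficient of `f` at time shift `αk` and modulation `βl`. -/
noncomputable def gaborCoeff (g : ℝ → ℂ) (α β : ℝ) (f : ℝ → ℂ) (kl : ℤ × ℤ) : ℂ :=
  ∫ x : ℝ, f x * (starRingEnd ℂ)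
    (Complex.exp (2 * Real.pi * Complex.I * (β * kl.2 * x)) * g (x - α * kl.1))

lemma gaborCoeff_eq_intervalIntegral {f g : ℝ → ℂ} (hf : Continuous f)
    (hfc : HasCompactSupport f) (hg : Continuous g) {α β δ : ℝ} (hδ : 0 < δ) (hβ : β * δ = 1)
    {a : ℝ} {S : Finset ℤ}
    (hS : ∀ y ∈ Set.Icc a (a + 1), ∀ n ∉ S, f ((y + (n : ℤ)) * δ) = 0) (k l : ℤ) :
    gaborCoeff g α β f (k, l) = δ * ∫ y in a..(a + 1), expTwoPiI (-(l * y)) *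
      ∑ n ∈ S, fiberSeq f δ S y n * (starRingEnd ℂ) (g (y * δ + n * δ - α * k)) := by
  set U : ℝ → ℂ := fun x => f x * (starRingEnd ℂ)
    (Complex.exp (2 * Real.pi * Complex.I * (β * l * x)) * g (x - α * k)) with hU
  have hUc : Continuous U := by
    have : Continuous fun x : ℝ => (starRingEnd ℂ)
        (Complex.exp (2 * Real.pi * Complex.I * (β * l * x)) * g (x - α * k)) :=
      Complex.continuous_conj.comp (by fun_prop)
    exact hf.mul this
  have hi : Integrable U := hUc.integrable_of_hasCompactSupport hfc.mul_right
  have h := integral_eq_intervalIntegral_sum (u := fun y => U (y * δ)) (by fun_prop)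
    (hi.comp_mul_right' hδ.ne') (a := a) (S := S)
    (fun y hy n hn => by simp only [hU, hS y hy n hn, zero_mul])
  rw [Measure.integral_comp_mul_right U δ, abs_of_pos (by positivity)] at h
  have h1 : gaborCoeff g α β f (k, l) = ∫ x, U x := rfl
  have h2 : ∫ x, U x = δ * ((δ⁻¹ : ℝ) • ∫ x, U x) := by
    rw [Complex.real_smul, ← mul_assoc, ← Complex.ofReal_mul, mul_inv_cancel₀ hδ.ne']
    simp
  rw [h1, h2, h]
  congr 1
  refine intervalIntegral.integral_congr fun y _ => ?_
  simp only [Finset.mul_sum]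
  refine Finset.sum_congr rfl fun n hn => ?_
  have h3 : Complex.exp (2 * Real.pi * Complex.I * (β * l * ((y + n) * δ : ℝ))) =
      expTwoPiI (l * y) := by
    have : (l * y : ℝ) + ((l * n : ℤ) : ℝ) = β * l * ((y + n) * δ) := by
      push_cast
      linear_combination (-(l * y + l * n : ℝ)) * hβ
    rw [← expTwoPiI_add_int _ (l * n), this, expTwoPiI]
    push_cast
    rfl
  simp only [hU, h3, map_mul, conj_expTwoPiI, fiberSeq, if_pos hn]
  rw [← add_mul y (n : ℝ) δ]
  ring

/-- The energy of the Gabor coefficients of `f` carried by the fibre over `yδ`. -/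
noncomputable def fiberEnergy (g : ℝ → ℂ) (α δ : ℝ) (p q : ℕ) (f : ℝ → ℂ) (S : Finset ℤ)
    (y : ℝ) : ℝ :=
  (q : ℝ)⁻¹ * ∫ τ in (0 : ℝ)..1,
    zakForm g α δ p q (fun s => residueSeries p (fiberSeq f δ S y) s τ) (y * δ) τ

lemma continuous_fiberEnergy {f g : ℝ → ℂ} (hf : Continuous f) (hg : Continuous g) {α : ℝ}
    (hα : 0 < α) (hW : TranslatesDominated g α) (δ : ℝ) {p : ℕ} (hp : 0 < p) (q : ℕ)
    (S : Finset ℤ) : Continuous (fiberEnergy g α δ p q f S) := by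
  refine continuous_const.mul
    (intervalIntegral.continuous_parametric_intervalIntegral_of_continuous' ?_ _ _)
  refine continuous_zakForm_comp hg hα hW δ q (continuous_pi fun s => ?_) (by fun_prop)
    continuous_snd
  exact continuous_residueSeries_comp hp
    (fun n => (continuous_fiberSeq hf δ S n).comp continuous_fst)
    (fun z => fiberSeq_eq_zero f δ S z.1) continuous_snd s

/-- The fibrewise formula for the frame sum of a compactly supported continuous function. -/
lemma hasSum_gaborCoeff {f g : ℝ → ℂ} (hf : Continuous f) (hfc : HasCompactSupport f)
    (hg : Continuous g) {α β δ : ℝ} (hα : 0 < α) (hW : TranslatesDominated g α)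
    {p q : ℕ} (hp : 0 < p) (hq : 0 < q) (hpq : p * δ = q * α)
    (hδ : 0 < δ) (hβ : β * δ = 1) {a : ℝ} {S : Finset ℤ}
    (hS : ∀ y ∈ Set.Icc a (a + 1), ∀ n ∉ S, f ((y + (n : ℤ)) * δ) = 0) :
    HasSum (fun kl => ‖gaborCoeff g α β f kl‖ ^ 2)
      (δ ^ 2 * ∫ y in a..(a + 1), fiberEnergy g α δ p q f S y) := by
  set Φ : ℤ → ℝ → ℂ := fun k y =>
    ∑ n ∈ S, fiberSeq f δ S y n * (starRingEnd ℂ) (g (y * δ + n * δ - α * k)) with hΦ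
  have hΦc : ∀ k, Continuous (Φ k) := fun k => by
    refine continuous_finsetSum _ fun n _ => ?_
    exact (continuous_fiberSeq hf δ S n).mul (Complex.continuous_conj.comp (by fun_prop))
  have hinner : ∀ k : ℤ, HasSum (fun l : ℤ => ‖gaborCoeff g α β f (k, l)‖ ^ 2)
      (δ ^ 2 * ∫ y in a..(a + 1), ‖Φ k y‖ ^ 2) := by
    intro k
    have hm : MemLp (Φ k) 2 (volume.restrict (Set.Ioc a (a + 1))) :=
      (memLp_two_iff_integrable_sq_norm (hΦc k).aestronglyMeasurable).2
        (((hΦc k).norm.pow 2).integrableOn_Ioc)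
    refine ((hasSum_sq_integral_expTwoPiI hm).mul_left (δ ^ 2)).congr fun u =>
      Finset.sum_congr rfl fun l _ => ?_
    beta_reduce
    rw [gaborCoeff_eq_intervalIntegral hf hfc hg hδ hβ hS, norm_mul, mul_pow,
      Complex.norm_of_nonneg hδ.le]
  have hHc := continuous_fiberEnergy hf hg hα hW δ hp q S
  have hfib : ∀ y, HasSum (fun k => ‖Φ k y‖ ^ 2) (fiberEnergy g α δ p q f S y) := fun y =>
    hasSum_fiber hg hα hW hp hq hpq (fiberSeq_eq_zero f δ S y) (y * δ)
  have houter : HasSum (fun k => ∫ y in a..(a + 1), ‖Φ k y‖ ^ 2)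
      (∫ y in a..(a + 1), fiberEnergy g α δ p q f S y) := by
    refine intervalIntegral.hasSum_integral_of_dominated_convergence
      (fun k y => ‖Φ k y‖ ^ 2) (fun k => ?_) (fun k => ?_) ?_ ?_ ?_
    · exact ((hΦc k).norm.pow 2).aestronglyMeasurable
    · exact .of_forall fun y _ => by simp
    · exact .of_forall fun y _ => (hfib y).summable
    · simp only [fun y => (hfib y).tsum_eq]
      exact hHc.intervalIntegrable _ _
    · exact .of_forall fun y _ => hfib y
  have hs : Summable fun kl : ℤ × ℤ => ‖gaborCoeff g α β f kl‖ ^ 2 := by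
    rw [summable_prod_of_nonneg fun _ => by positivity]
    refine ⟨fun k => (hinner k).summable, ?_⟩
    simp only [fun k => (hinner k).tsum_eq]
    exact houter.summable.mul_left _
  have h := hs.hasSum.prod_fiberwise hinner
  rw [← h.unique (houter.mul_left (δ ^ 2))]
  exact hs.hasSum

lemma sq_norm_sub_le_two_mul {E : Type*} [SeminormedAddCommGroup E] (x y : E) :
    ‖x‖ ^ 2 ≤ 2 * ‖y‖ ^ 2 + 2 * ‖x - y‖ ^ 2 := by
  have h := norm_sub_norm_le x y
  nlinarith [sq_nonneg (‖y‖ - ‖x - y‖), norm_nonneg x, norm_nonneg y, norm_nonneg (x - y)]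

/-- A Bessel bound on a dense set extends to the whole space. -/
lemma summable_of_dense {H ι : Type*} [NormedAddCommGroup H] [InnerProductSpace ℂ H]
    {γ : ι → H} {D : Set H} (hD : Dense D) {b : ℝ}
    (hs : ∀ f ∈ D, Summable fun i => ‖inner ℂ (γ i) f‖ ^ 2)
    (hb : ∀ f ∈ D, ∑' i, ‖inner ℂ (γ i) f‖ ^ 2 ≤ b * ‖f‖ ^ 2) (f : H) :
    Summable (fun i => ‖inner ℂ (γ i) f‖ ^ 2) ∧
      ∑' i, ‖inner ℂ (γ i) f‖ ^ 2 ≤ b * ‖f‖ ^ 2 := by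
  have key : ∀ (T : Finset ι) (f : H), ∑ i ∈ T, ‖inner ℂ (γ i) f‖ ^ 2 ≤ b * ‖f‖ ^ 2 := by
    intro T f
    have hcl : IsClosed {f : H | ∑ i ∈ T, ‖inner ℂ (γ i) f‖ ^ 2 ≤ b * ‖f‖ ^ 2} :=
      isClosed_le (by fun_prop) (by fun_prop)
    refine hcl.closure_subset_iff.2 (fun h hh => ?_) (hD f)
    exact ((hs h hh).sum_le_tsum T fun i _ => by positivity).trans (hb h hh)
  have hsum : Summable (fun i => ‖inner ℂ (γ i) f‖ ^ 2) :=
    summable_of_sum_le (fun i => by positivity) fun T => key T f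
  exact ⟨hsum, hsum.tsum_le_of_sum_le fun T => key T f⟩

/-- A lower frame bound on a dense set extends, up to a factor `2`, to the whole space. -/
lemma le_tsum_of_dense {H ι : Type*} [NormedAddCommGroup H] [InnerProductSpace ℂ H]
    {γ : ι → H} {D : Set H} (hD : Dense D) {a b : ℝ}
    (hs : ∀ f ∈ D, Summable fun i => ‖inner ℂ (γ i) f‖ ^ 2)
    (hb : ∀ f ∈ D, ∑' i, ‖inner ℂ (γ i) f‖ ^ 2 ≤ b * ‖f‖ ^ 2)
    (ha : ∀ f ∈ D, a * ‖f‖ ^ 2 ≤ ∑' i, ‖inner ℂ (γ i) f‖ ^ 2) (f : H) :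
    a / 2 * ‖f‖ ^ 2 ≤ ∑' i, ‖inner ℂ (γ i) f‖ ^ 2 := by
  have hf := summable_of_dense hD hs hb
  have hcl : IsClosed {h : H | a * ‖h‖ ^ 2 ≤
      2 * ∑' i, ‖inner ℂ (γ i) f‖ ^ 2 + 2 * (b * ‖h - f‖ ^ 2)} :=
    isClosed_le (by fun_prop) (by fun_prop)
  have key := hcl.closure_subset_iff.2 (fun h hh => ?_) (hD f)
  · simp only [Set.mem_ofPred_eq, sub_self, norm_zero] at key
    linarith
  have h1 : ∑' i, ‖inner ℂ (γ i) h‖ ^ 2 ≤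
      ∑' i, (2 * ‖inner ℂ (γ i) f‖ ^ 2 + 2 * ‖inner ℂ (γ i) (h - f)‖ ^ 2) := by
    refine (hs h hh).tsum_le_tsum (fun i => ?_)
      (((hf f).1.mul_left 2).add ((hf (h - f)).1.mul_left 2))
    rw [inner_sub_right]
    exact sq_norm_sub_le_two_mul _ _
  rw [((hf f).1.mul_left 2).tsum_add ((hf (h - f)).1.mul_left 2), tsum_mul_left,
    tsum_mul_left] at h1
  have h2 := (hf (h - f)).2
  have h3 := ha h hh
  simp only [Set.mem_ofPred_eq]
  linarith

lemma dense_continuous_hasCompactSupport :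
    Dense {f : Lp ℂ 2 (volume : Measure ℝ) |
      ∃ h : ℝ → ℂ, f =ᵐ[volume] h ∧ HasCompactSupport h ∧ Continuous h} := by
  refine (Lp.dense_hasCompactSupport_contDiff (F := ℂ) (by simp)).mono ?_
  rintro f ⟨h, h1, h2, h3⟩
  exact ⟨h, h1, h2, h3.continuous⟩

lemma gaborCoeff_congr {g : ℝ → ℂ} {α β : ℝ} {f h : ℝ → ℂ} (hfh : f =ᵐ[volume] h) (kl : ℤ × ℤ) :
    gaborCoeff g α β f kl = gaborCoeff g α β h kl :=
  integral_congr_ae (hfh.mono fun x hx => by simp only [hx])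

lemma exists_inner_eq_gaborCoeff {g : ℝ → ℂ} (hg : Continuous g) (hg2 : MemLp g 2 volume)
    (α β : ℝ) : ∃ γ : ℤ × ℤ → Lp ℂ 2 (volume : Measure ℝ), ∀ kl f,
      inner ℂ (γ kl) f = gaborCoeff g α β f kl := by
  have hm : ∀ kl : ℤ × ℤ, MemLp (fun x : ℝ =>
      Complex.exp (2 * Real.pi * Complex.I * (β * kl.2 * x)) * g (x - α * kl.1)) 2 volume := by
    intro kl
    refine MemLp.of_le (hg2.comp_measurePreserving
      (measurePreserving_sub_right volume (α * kl.1 : ℝ))) ?_ (.of_forall fun x => ?_)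
    · exact Continuous.aestronglyMeasurable (by fun_prop)
    · have : Complex.exp (2 * Real.pi * Complex.I * (β * kl.2 * x)) =
          expTwoPiI (β * kl.2 * x) := by
        rw [expTwoPiI]
        push_cast
        rfl
      rw [this, norm_mul, norm_expTwoPiI, one_mul]
      rfl
  refine ⟨fun kl => (hm kl).toLp, fun kl f => ?_⟩
  rw [L2.inner_def, gaborCoeff]
  refine integral_congr_ae ((hm kl).coeFn_toLp.mono fun x hx => ?_)
  simp only [hx, RCLike.inner_apply]

lemma Lp_norm_sq_eq {f : Lp ℂ 2 (volume : Measure ℝ)} {h : ℝ → ℂ} (hfh : f =ᵐ[volume] h) :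
    ‖f‖ ^ 2 = ∫ x, ‖h x‖ ^ 2 := by
  have h : ((‖f‖ : ℂ)) ^ 2 = ∫ x, ((‖h x‖ ^ 2 : ℝ) : ℂ) := by
    rw [← Complex.coe_algebraMap, ← inner_self_eq_norm_sq_to_K (𝕜 := ℂ) f, L2.inner_def]
    refine integral_congr_ae (hfh.mono fun x hx => ?_)
    simp only [hx, inner_self_eq_norm_sq_to_K]
    push_cast
    rfl
  rw [integral_complex_ofReal] at h
  exact_mod_cast h

lemma gaborFrame_of_bounds {g : ℝ → ℂ} (hg : Continuous g) (hg2 : MemLp g 2 volume) {α β a b : ℝ}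
    (ha : 0 < a) (hb : 0 < b)
    (h : ∀ f : ℝ → ℂ, Continuous f → HasCompactSupport f →
      Summable (fun kl => ‖gaborCoeff g α β f kl‖ ^ 2) ∧
      a * ∫ x, ‖f x‖ ^ 2 ≤ ∑' kl, ‖gaborCoeff g α β f kl‖ ^ 2 ∧
      ∑' kl, ‖gaborCoeff g α β f kl‖ ^ 2 ≤ b * ∫ x, ‖f x‖ ^ 2) :
    GaborFrame g α β := by
  obtain ⟨γ, hγ⟩ := exists_inner_eq_gaborCoeff hg hg2 α β
  have hD := dense_continuous_hasCompactSupport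
  have key : ∀ f ∈ {f : Lp ℂ 2 (volume : Measure ℝ) |
      ∃ h : ℝ → ℂ, f =ᵐ[volume] h ∧ HasCompactSupport h ∧ Continuous h},
      Summable (fun kl => ‖inner ℂ (γ kl) f‖ ^ 2) ∧
      a * ‖f‖ ^ 2 ≤ ∑' kl, ‖inner ℂ (γ kl) f‖ ^ 2 ∧
      ∑' kl, ‖inner ℂ (γ kl) f‖ ^ 2 ≤ b * ‖f‖ ^ 2 := by
    rintro f ⟨u, hu, huc, hu'⟩
    simp only [hγ, Lp_norm_sq_eq hu, gaborCoeff_congr hu]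
    exact h u hu' huc
  refine ⟨a / 2, b, by positivity, hb, fun f => ?_⟩
  have h1 := le_tsum_of_dense hD (fun f hf => (key f hf).1) (fun f hf => (key f hf).2.2)
    (fun f hf => (key f hf).2.1) f
  have h2 := summable_of_dense hD (fun f hf => (key f hf).1) (fun f hf => (key f hf).2.2) f
  simp only [hγ] at h1 h2
  exact ⟨h1, h2.2⟩

lemma tsum_gaborCoeff_of_gaborFrame {g : ℝ → ℂ} {α β : ℝ} (h : GaborFrame g α β) :
    ∃ a > 0, ∀ f : ℝ → ℂ, Continuous f → HasCompactSupport f →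
      a * ∫ x, ‖f x‖ ^ 2 ≤ ∑' kl, ‖gaborCoeff g α β f kl‖ ^ 2 := by
  obtain ⟨a, b, ha, -, hab⟩ := h
  refine ⟨a, ha, fun f hf hfc => ?_⟩
  have hm : MemLp f 2 volume := hf.memLp_of_hasCompactSupport hfc
  have h1 := (hab hm.toLp).1
  rw [Lp_norm_sq_eq hm.coeFn_toLp] at h1
  refine h1.trans_eq (tsum_congr fun kl => ?_)
  rw [← gaborCoeff_congr hm.coeFn_toLp]
  rfl

lemma intervalIntegral_fiberEnergy_le {f g : ℝ → ℂ} (hf : Continuous f) (hfc : HasCompactSupport f)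
    (hg : Continuous g) {α δ : ℝ} (hα : 0 < α) (hW : TranslatesDominated g α)
    {p q : ℕ} (hp : 0 < p) (hδ : 0 < δ) {S : Finset ℤ}
    (hS : ∀ y ∈ Set.Icc (0 : ℝ) (0 + 1), ∀ n ∉ S, f ((y + (n : ℤ)) * δ) = 0) {C : ℝ}
    (hC : ∀ x ∈ Set.Icc (0 : ℝ) δ, ∀ τ ∈ Set.Icc (0 : ℝ) 1, ∀ v : Fin p → ℂ,
      zakForm g α δ p q v x τ ≤ C * ∑ s, ‖v s‖ ^ 2) :
    δ ^ 2 * ∫ y in (0 : ℝ)..(0 + 1), fiberEnergy g α δ p q f S y ≤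
      δ * (q : ℝ)⁻¹ * C * ∫ x, ‖f x‖ ^ 2 := by
  rw [integral_sq_eq_fiber hf hfc hδ hS]
  have hc : Continuous fun y => ∑' n, ‖fiberSeq f δ S y n‖ ^ 2 := by
    simp only [tsum_sq_fiberSeq]
    fun_prop
  have h : ∫ y in (0 : ℝ)..(0 + 1), fiberEnergy g α δ p q f S y ≤
      ∫ y in (0 : ℝ)..(0 + 1), (q : ℝ)⁻¹ * (C * ∑' n, ‖fiberSeq f δ S y n‖ ^ 2) := by
    refine intervalIntegral.integral_mono_on (by norm_num)
      ((continuous_fiberEnergy hf hg hα hW δ hp q S).intervalIntegrable _ _)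
      ((continuous_const.mul (continuous_const.mul hc)).intervalIntegrable _ _) fun y hy => ?_
    refine mul_le_mul_of_nonneg_left ?_ (by positivity)
    refine intervalIntegral_zakForm_le hg hα hW hp (hC _ ?_) (fiberSeq_eq_zero f δ S y)
    exact ⟨mul_nonneg hy.1 hδ.le, by nlinarith [hy.2]⟩
  simp only [intervalIntegral.integral_const_mul] at h
  nlinarith [mul_le_mul_of_nonneg_left h (sq_nonneg δ)]

lemma le_intervalIntegral_fiberEnergy {f g : ℝ → ℂ} (hf : Continuous f) (hfc : HasCompactSupport f)
    (hg : Continuous g) {α δ : ℝ} (hα : 0 < α) (hW : TranslatesDominated g α)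
    {p q : ℕ} (hp : 0 < p) (hδ : 0 < δ) {S : Finset ℤ}
    (hS : ∀ y ∈ Set.Icc (0 : ℝ) (0 + 1), ∀ n ∉ S, f ((y + (n : ℤ)) * δ) = 0) {c : ℝ}
    (hc : ∀ x ∈ Set.Icc (0 : ℝ) δ, ∀ τ ∈ Set.Icc (0 : ℝ) 1, ∀ v : Fin p → ℂ,
      c * ∑ s, ‖v s‖ ^ 2 ≤ zakForm g α δ p q v x τ) :
    δ * (q : ℝ)⁻¹ * c * ∫ x, ‖f x‖ ^ 2 ≤
      δ ^ 2 * ∫ y in (0 : ℝ)..(0 + 1), fiberEnergy g α δ p q f S y := by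
  rw [integral_sq_eq_fiber hf hfc hδ hS]
  have hc' : Continuous fun y => ∑' n, ‖fiberSeq f δ S y n‖ ^ 2 := by
    simp only [tsum_sq_fiberSeq]
    fun_prop
  have h : ∫ y in (0 : ℝ)..(0 + 1), (q : ℝ)⁻¹ * (c * ∑' n, ‖fiberSeq f δ S y n‖ ^ 2) ≤
      ∫ y in (0 : ℝ)..(0 + 1), fiberEnergy g α δ p q f S y := by
    refine intervalIntegral.integral_mono_on (by norm_num)
      ((continuous_const.mul (continuous_const.mul hc')).intervalIntegrable _ _)
      ((continuous_fiberEnergy hf hg hα hW δ hp q S).intervalIntegrable _ _) fun y hy => ?_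
    refine mul_le_mul_of_nonneg_left ?_ (by positivity)
    refine le_intervalIntegral_zakForm hg hα hW hp (hc _ ?_) (fiberSeq_eq_zero f δ S y)
    exact ⟨mul_nonneg hy.1 hδ.le, by nlinarith [hy.2]⟩
  simp only [intervalIntegral.integral_const_mul] at h
  nlinarith [mul_le_mul_of_nonneg_left h (sq_nonneg δ)]

theorem gaborFrame_of_nondegenerate {g : ℝ → ℂ} (hg : Continuous g) (hg2 : MemLp g 2 volume)
    {α β δ : ℝ} (hα : 0 < α) (hW : TranslatesDominated g α) {p q : ℕ} (hp : 0 < p) (hq : 0 < q)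
    (hpq : p * δ = q * α) (hδ : 0 < δ) (hβ : β * δ = 1)
    (hnd : ∀ x τ v, zakForm g α δ p q v x τ = 0 → v = 0) : GaborFrame g α β := by
  obtain ⟨C, hC0, hC⟩ := exists_zakForm_le hg (δ := δ) hα hW p q
  obtain ⟨c, hc0, hc⟩ := exists_le_zakForm hg hα hW hp q hnd
  refine gaborFrame_of_bounds hg hg2 (a := δ * (q : ℝ)⁻¹ * c) (b := δ * (q : ℝ)⁻¹ * C)
    (by positivity) (by positivity) fun f hf hfc => ?_
  obtain ⟨S, hS⟩ := exists_finset_shift hfc hδ 0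
  have h := hasSum_gaborCoeff hf hfc hg hα hW hp hq hpq hδ hβ hS
  rw [h.tsum_eq]
  exact ⟨h.summable, le_intervalIntegral_fiberEnergy hf hfc hg hα hW hp hδ hS hc,
    intervalIntegral_fiberEnergy_le hf hfc hg hα hW hp hδ hS hC⟩

/-- The function on `ℝ` that places the copies `b n • φ` of a bump at the points of a coset. -/
noncomputable def bumpComb (b : ℤ → ℂ) (S : Finset ℤ) (φ : ℝ → ℝ) (β x : ℝ) : ℂ :=
  ∑ n ∈ S, b n * φ (x * β - n)

lemma continuous_bumpComb (b : ℤ → ℂ) (S : Finset ℤ) {φ : ℝ → ℝ} (hφ : Continuous φ) (β : ℝ) :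
    Continuous (bumpComb b S φ β) := by
  unfold bumpComb
  fun_prop

lemma bumpComb_apply {b : ℤ → ℂ} {S : Finset ℤ} (hb : ∀ n ∉ S, b n = 0) {φ : ℝ → ℝ} {y₀ : ℝ}
    (hφ : ∀ y, 1 / 2 ≤ |y - y₀| → φ y = 0) {β δ : ℝ} (hβ : β * δ = 1) {y : ℝ}
    (hy : |y - y₀| ≤ 1 / 2) (n : ℤ) : bumpComb b S φ β ((y + n) * δ) = b n * φ y := by
  have hδ : (y + n) * δ * β = y + n := by linear_combination (y + n) * hβ
  have h : ∀ m ∈ S, m ≠ n → b m * (φ ((y + n) * δ * β - m) : ℂ) = 0 := by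
    intro m _ hmn
    rw [hδ, hφ, Complex.ofReal_zero, mul_zero]
    have h1 : (1 : ℝ) ≤ |(n - m : ℝ)| := by
      exact_mod_cast Int.one_le_abs (sub_ne_zero.2 hmn.symm)
    have h2 := abs_sub_abs_le_abs_sub (n - m : ℝ) (-(y - y₀))
    rw [abs_neg] at h2
    have h3 : y + n - m - y₀ = (n - m : ℝ) - -(y - y₀) := by ring
    rw [h3]
    linarith
  have hδn : (y + n) * δ * β - n = y := by rw [hδ]; ring
  rw [bumpComb, Finset.sum_eq_single n h, hδn]
  intro hn
  rw [hb n hn, zero_mul]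

lemma hasCompactSupport_bumpComb {b : ℤ → ℂ} {S : Finset ℤ} {φ : ℝ → ℝ} {y₀ : ℝ}
    (hφ : ∀ y, 1 / 2 ≤ |y - y₀| → φ y = 0) {β : ℝ} (hβ : 0 < β) :
    HasCompactSupport (bumpComb b S φ β) := by
  refine HasCompactSupport.intro
    (K := ⋃ n ∈ S, Set.Icc ((y₀ + n - 1 / 2) / β) ((y₀ + n + 1 / 2) / β))
    (S.isCompact_biUnion fun n _ => isCompact_Icc) fun x hx => ?_
  refine Finset.sum_eq_zero fun n hn => ?_
  rw [hφ, Complex.ofReal_zero, mul_zero]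
  by_contra! h
  rw [abs_lt] at h
  refine hx (Set.mem_biUnion hn ⟨?_, ?_⟩)
  · rw [div_le_iff₀ hβ]
    linarith
  · rw [le_div_iff₀ hβ]
    linarith

/-- Testing a lower frame bound on bump combinations gives a weighted bound on the fibres. -/
lemma weighted_fiber_bound {g : ℝ → ℂ} (hg : Continuous g) {α β δ : ℝ} (hα : 0 < α)
    (hW : TranslatesDominated g α) {p q : ℕ} (hp : 0 < p) (hq : 0 < q) (hpq : p * δ = q * α)
    (hδ : 0 < δ) (hβ : β * δ = 1) {a : ℝ}
    (h : ∀ f : ℝ → ℂ, Continuous f → HasCompactSupport f →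
      a * ∫ x, ‖f x‖ ^ 2 ≤ ∑' kl, ‖gaborCoeff g α β f kl‖ ^ 2)
    {b : ℤ → ℂ} {S : Finset ℤ} (hb : ∀ n ∉ S, b n = 0) {φ : ℝ → ℝ} (hφc : Continuous φ) {y₀ : ℝ}
    (hφ : ∀ y, 1 / 2 ≤ |y - y₀| → φ y = 0) :
    a * (δ * ∫ y in (y₀ - 1 / 2)..(y₀ - 1 / 2 + 1), φ y ^ 2 * ∑' n, ‖b n‖ ^ 2) ≤
      δ ^ 2 * ∫ y in (y₀ - 1 / 2)..(y₀ - 1 / 2 + 1), φ y ^ 2 * ((q : ℝ)⁻¹ *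
        ∫ τ in (0 : ℝ)..1, zakForm g α δ p q (fun s => residueSeries p b s τ) (y * δ) τ) := by
  have hβ0 : 0 < β := pos_of_mul_pos_left (by rw [hβ]; exact one_pos) hδ.le
  have hfc := continuous_bumpComb b S hφc β
  have hfs := hasCompactSupport_bumpComb (b := b) (S := S) hφ hβ0
  have hI : ∀ y ∈ Set.Icc (y₀ - 1 / 2) (y₀ - 1 / 2 + 1), |y - y₀| ≤ 1 / 2 := fun y hy => by
    rw [abs_le]
    constructor <;> linarith [hy.1, hy.2]
  have happ : ∀ y ∈ Set.Icc (y₀ - 1 / 2) (y₀ - 1 / 2 + 1), ∀ n : ℤ,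
      bumpComb b S φ β ((y + n) * δ) = b n * φ y := fun y hy n =>
    bumpComb_apply hb hφ hβ (hI y hy) n
  have hS : ∀ y ∈ Set.Icc (y₀ - 1 / 2) (y₀ - 1 / 2 + 1), ∀ n ∉ S,
      bumpComb b S φ β ((y + (n : ℤ)) * δ) = 0 := fun y hy n hn => by
    rw [happ y hy, hb n hn, zero_mul]
  have hseq : ∀ y ∈ Set.Icc (y₀ - 1 / 2) (y₀ - 1 / 2 + 1),
      fiberSeq (bumpComb b S φ β) δ S y = fun n => b n * φ y := fun y hy => by
    funext n
    by_cases hn : n ∈ S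
    · rw [fiberSeq, if_pos hn, happ y hy]
    · rw [fiberSeq, if_neg hn, hb n hn, zero_mul]
  have h1 := h _ hfc hfs
  rw [(hasSum_gaborCoeff hfc hfs hg hα hW hp hq hpq hδ hβ hS).tsum_eq,
    integral_sq_eq_fiber hfc hfs hδ hS] at h1
  have e1 : ∫ y in (y₀ - 1 / 2)..(y₀ - 1 / 2 + 1),
      ∑' n, ‖fiberSeq (bumpComb b S φ β) δ S y n‖ ^ 2 =
      ∫ y in (y₀ - 1 / 2)..(y₀ - 1 / 2 + 1), φ y ^ 2 * ∑' n, ‖b n‖ ^ 2 := by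
    refine intervalIntegral.integral_congr fun y hy => ?_
    rw [Set.uIcc_of_le (by linarith)] at hy
    simp only [hseq y hy, norm_mul, mul_pow, Complex.norm_real, Real.norm_eq_abs, sq_abs]
    rw [tsum_mul_right, mul_comm]
  have e2 : ∫ y in (y₀ - 1 / 2)..(y₀ - 1 / 2 + 1), fiberEnergy g α δ p q (bumpComb b S φ β) S y =
      ∫ y in (y₀ - 1 / 2)..(y₀ - 1 / 2 + 1), φ y ^ 2 * ((q : ℝ)⁻¹ *
        ∫ τ in (0 : ℝ)..1, zakForm g α δ p q (fun s => residueSeries p b s τ) (y * δ) τ) := by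
    refine intervalIntegral.integral_congr fun y hy => ?_
    rw [Set.uIcc_of_le (by linarith)] at hy
    have hr : ∀ s τ, residueSeries p (fun n => b n * φ y) s τ = residueSeries p b s τ * φ y := by
      intro s τ
      rw [residueSeries, residueSeries, ← tsum_mul_right]
      refine tsum_congr fun m => ?_
      rw [map_mul, Complex.conj_ofReal]
      ring
    simp only [fiberEnergy, hseq y hy, hr, zakForm_mul, Complex.norm_real, Real.norm_eq_abs,
      sq_abs, intervalIntegral.integral_const_mul]
    ring
  rwa [e1, e2] at h1

lemma fiber_lower_bound {g : ℝ → ℂ} (hg : Continuous g) {α β δ : ℝ} (hα : 0 < α)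
    (hW : TranslatesDominated g α) {p q : ℕ} (hp : 0 < p) (hq : 0 < q) (hpq : p * δ = q * α)
    (hδ : 0 < δ) (hβ : β * δ = 1) {a : ℝ}
    (h : ∀ f : ℝ → ℂ, Continuous f → HasCompactSupport f →
      a * ∫ x, ‖f x‖ ^ 2 ≤ ∑' kl, ‖gaborCoeff g α β f kl‖ ^ 2)
    {b : ℤ → ℂ} {S : Finset ℤ} (hb : ∀ n ∉ S, b n = 0) (y₀ : ℝ) :
    a * ∑' n, ‖b n‖ ^ 2 ≤ δ * ((q : ℝ)⁻¹ *
      ∫ τ in (0 : ℝ)..1, zakForm g α δ p q (fun s => residueSeries p b s τ) (y₀ * δ) τ) := by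
  set N := ∑' n, ‖b n‖ ^ 2
  set E : ℝ → ℝ := fun y => (q : ℝ)⁻¹ *
    ∫ τ in (0 : ℝ)..1, zakForm g α δ p q (fun s => residueSeries p b s τ) (y * δ) τ
  have hEc : Continuous E := by
    refine continuous_const.mul
      (intervalIntegral.continuous_parametric_intervalIntegral_of_continuous' ?_ _ _)
    exact continuous_zakForm_comp hg hα hW δ q
      (continuous_pi fun s => (continuous_residueSeries hp hb s).comp continuous_snd)
      (by fun_prop) continuous_snd
  by_contra! hlt
  set D : ℝ → ℝ := fun y => a * N - δ * E y with hD
  have hDc : Continuous D := by fun_prop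
  set φ : ℝ → ℝ := fun y => max 0 (D y) * max 0 (1 / 2 - |y - y₀|) with hφ
  have hφc : Continuous φ := by fun_prop
  have hφ0 : ∀ y, 1 / 2 ≤ |y - y₀| → φ y = 0 := fun y hy => by
    simp only [hφ]
    rw [max_eq_left (b := 1 / 2 - |y - y₀|) (by linarith), mul_zero]
  have h1 := weighted_fiber_bound hg hα hW hp hq hpq hδ hβ h hb hφc hφ0
  have hpos : 0 < ∫ y in (y₀ - 1 / 2)..(y₀ - 1 / 2 + 1), φ y ^ 2 * D y := by
    refine intervalIntegral.integral_pos (by linarith) (by fun_prop) (fun y _ => ?_)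
      ⟨y₀, ⟨by linarith, by linarith⟩, ?_⟩
    · rcases le_total 0 (D y) with hy | hy
      · positivity
      · simp only [hφ, max_eq_left hy]
        simp
    · have h2 : 0 < D y₀ := sub_pos.2 hlt
      have h3 : φ y₀ = D y₀ * (1 / 2) := by
        simp [hφ, max_eq_right h2.le]
      rw [h3]
      positivity
  have hsplit : ∫ y in (y₀ - 1 / 2)..(y₀ - 1 / 2 + 1), φ y ^ 2 * D y =
      a * (∫ y in (y₀ - 1 / 2)..(y₀ - 1 / 2 + 1), φ y ^ 2 * N) -
      δ * ∫ y in (y₀ - 1 / 2)..(y₀ - 1 / 2 + 1), φ y ^ 2 * E y := by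
    rw [← intervalIntegral.integral_const_mul, ← intervalIntegral.integral_const_mul,
      ← intervalIntegral.integral_sub]
    · refine intervalIntegral.integral_congr fun y _ => ?_
      simp only [hD]
      ring
    · exact Continuous.intervalIntegrable (by fun_prop) _ _
    · exact Continuous.intervalIntegrable (by fun_prop) _ _
  rw [hsplit] at hpos
  nlinarith [mul_pos hδ hpos]

theorem nondegenerate_of_gaborFrame {g : ℝ → ℂ} (hg : Continuous g)
    {α β δ : ℝ} (hα : 0 < α) (hW : TranslatesDominated g α) {p q : ℕ} (hp : 0 < p) (hq : 0 < q)
    (hpq : p * δ = q * α) (hδ : 0 < δ) (hβ : β * δ = 1) (hG : GaborFrame g α β)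
    (x τ : ℝ) (v : Fin p → ℂ) (h0 : zakForm g α δ p q v x τ = 0) : v = 0 := by
  obtain ⟨a, ha, h⟩ := tsum_gaborCoeff_of_gaborFrame hG
  have hx : x / δ * δ = x := div_mul_cancel₀ x hδ.ne'
  have h1 := le_zakForm_of_forall_seq (δ := δ) (c := a * q / δ) (x := x) hg hα hW hp hq
    (fun b S hb => ?_) v τ
  · rw [h0] at h1
    have h2 : ∑ s, ‖v s‖ ^ 2 ≤ 0 := nonpos_of_mul_nonpos_right h1 (by positivity)
    have h3 := (Finset.sum_eq_zero_iff_of_nonneg fun s _ => by positivity).1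
      (h2.antisymm (Finset.sum_nonneg fun s _ => by positivity))
    funext s
    simpa using h3 s (Finset.mem_univ s)
  have h2 := fiber_lower_bound hg hα hW hp hq hpq hδ hβ h hb (x / δ)
  rw [hx] at h2
  have hq' : (0 : ℝ) < q := by exact_mod_cast hq
  rw [div_mul_eq_mul_div, div_le_iff₀ hδ]
  have h3 := mul_le_mul_of_nonneg_left h2 hq'.le
  field_simp at h3
  nlinarith

lemma rank_eq_card_iff_det_ne_zero {n K : Type*} [Fintype n] [DecidableEq n] [Field K]
    (M : Matrix n n K) : M.rank = Fintype.card n ↔ M.det ≠ 0 := by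
  refine ⟨fun h => ?_, fun h => rank_of_det_ne_zero h⟩
  rw [rank_eq_finrank_span_row] at h
  have h1 : LinearIndependent K M.row := linearIndependent_iff_card_eq_finrank_span.2 h.symm
  exact (isUnit_iff_isUnit_det M).1 (linearIndependent_rows_iff_isUnit.1 h1) |>.ne_zero

open ComplexOrder in
lemma det_mul_conjTranspose_ne_zero_iff_rank {p q : ℕ} (Q : Matrix (Fin p) (Fin q) ℂ) :
    (Q * Qᴴ).det ≠ 0 ↔ Q.rank = p := by
  rw [← rank_eq_card_iff_det_ne_zero, rank_self_mul_conjTranspose, Fintype.card_fin]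

open ComplexOrder in
lemma det_mul_conjTranspose_ne_zero_iff {p q : ℕ} (Q : Matrix (Fin p) (Fin q) ℂ) :
    (Q * Qᴴ).det ≠ 0 ↔ ∀ w, w ᵥ* Q = 0 → w = 0 := by
  rw [Ne, ← exists_vecMul_eq_zero_iff]
  simp only [vecMul_self_mul_conjTranspose_eq_zero]
  push Not
  exact forall_congr' fun w => not_imp_not

/-- Multiplication by `q` modulo `p`, as a permutation of `Fin p`. -/
noncomputable def mulModEquiv {p q : ℕ} (hp : 0 < p) (hpq : p.Coprime q) : Fin p ≃ Fin p :=
  Equiv.ofBijective (fun s => ⟨q * s % p, Nat.mod_lt _ hp⟩) <| by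
    rw [← Finite.injective_iff_bijective]
    intro s t hst
    have h : q * (s : ℕ) ≡ q * t [MOD p] := congrArg Fin.val hst
    exact Fin.ext ((Nat.ModEq.cancel_left_of_coprime hpq h).eq_of_lt_of_lt s.2 t.2)

lemma mulModEquiv_apply {p q : ℕ} (hp : 0 < p) (hpq : p.Coprime q) (s : Fin p) :
    (mulModEquiv hp hpq s : ℕ) = q * s % p := rfl

lemma unitZak_shift_eq_Qmat (g : ℝ → ℂ) {α β δ : ℝ} {p q : ℕ} (hp : 0 < p)
    (hq : 0 < q) (hpq : p.Coprime q) (hαβ : α * β = (p : ℝ) / q) (hδ : p * δ = q * α) (x ξ : ℝ)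
    (s : Fin p) (k : Fin q) :
    unitZak g α (x + (s : ℕ) * δ) ((q * (α * ξ) + ((-(p * k) : ℤ) : ℝ)) / q) =
      expTwoPiI ((q * s / p : ℕ) * (α * ξ)) *
        Qmat g α β p q x ξ (mulModEquiv hp hpq s) k := by
  have hp' : (p : ℝ) ≠ 0 := by exact_mod_cast hp.ne'
  have hq' : (q : ℝ) ≠ 0 := by exact_mod_cast hq.ne'
  set u : ℕ := q * s / p with hu
  set i := mulModEquiv hp hpq s with hi
  have hN : (q : ℝ) * (s : ℕ) = (i : ℕ) + p * u := by
    have := Nat.mod_add_div (q * s) p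
    rw [hi, mulModEquiv_apply]
    exact_mod_cast this.symm
  have hx : x + (s : ℕ) * δ = (x + α * (i : ℕ) / p) + α * ((u : ℤ) : ℝ) := by
    have hδ' : δ = q * α / p := by field_simp; linarith
    rw [hδ']
    field_simp
    push_cast
    linear_combination α * hN
  have hθ : (q * (α * ξ) + ((-(p * k) : ℤ) : ℝ)) / q = α * (ξ - β * (k : ℕ)) := by
    rw [mul_sub, ← mul_assoc α β, hαβ]
    push_cast
    field_simp
    ring
  rw [hx, unitZak_add_mul_int, hθ, Qmat, zak_eq_unitZak]
  have hph : Complex.exp (2 * Real.pi * Complex.I * (((i : ℕ) : ℝ) * (k : ℕ) / q)) =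
      expTwoPiI ((i : ℕ) * (k : ℕ) / q) := by
    rw [expTwoPiI]
    push_cast
    rfl
  have hph2 : expTwoPiI (((u : ℤ) : ℝ) * (α * (ξ - β * (k : ℕ)))) =
      expTwoPiI (u * (α * ξ)) * expTwoPiI ((i : ℕ) * (k : ℕ) / q) := by
    rw [← expTwoPiI_add, ← expTwoPiI_add_int _ ((s : ℕ) * (k : ℕ) : ℤ)]
    congr 1
    have : α * (ξ - β * (k : ℕ)) = α * ξ - p / q * (k : ℕ) := by rw [← hαβ]; ring
    rw [this]
    push_cast
    field_simp
    linear_combination (k : ℝ) * hN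
  rw [hph, hph2]
  ring

lemma zakForm_eq_zero_iff (g : ℝ → ℂ) {α δ : ℝ} {p q : ℕ} (hq : 0 < q) (hpq : p.Coprime q)
    (v : Fin p → ℂ) (x τ : ℝ) :
    zakForm g α δ p q v x τ = 0 ↔ ∀ k : Fin q,
      ∑ s : Fin p, v s * unitZak g α (x + (s : ℕ) * δ) ((τ + ((-(p * k) : ℤ) : ℝ)) / q) = 0 := by
  have hq' : (q : ℝ) ≠ 0 := by exact_mod_cast hq.ne'
  have : NeZero q := ⟨hq.ne'⟩
  have hper : ∀ (y : ℝ) (m n : ℤ), (q : ℤ) ∣ m - n →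
      unitZak g α y ((τ + m) / q) = unitZak g α y ((τ + n) / q) := by
    rintro y m n ⟨d, hd⟩
    rw [← unitZak_add_int g α y ((τ + n) / q) d]
    congr 1
    have : (m : ℝ) - n = q * d := by exact_mod_cast hd
    field_simp
    linarith
  have hz : zakForm g α δ p q v x τ = 0 ↔ ∀ j : Fin q,
      ∑ s : Fin p, v s * unitZak g α (x + (s : ℕ) * δ) ((τ + ((j : ℤ) : ℝ)) / q) = 0 := by
    rw [zakForm, Finset.sum_eq_zero_iff_of_nonneg fun _ _ => by positivity]
    simp
  rw [hz]
  constructor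
  · intro h k
    have h1 := h ⟨((-(p * k) : ℤ) : ZMod q).val, ZMod.val_lt _⟩
    rw [← h1]
    refine Finset.sum_congr rfl fun s _ => ?_
    rw [hper]
    rw [← ZMod.intCast_zmod_eq_zero_iff_dvd]
    simp
  · intro h j
    obtain ⟨k, hk⟩ : ∃ k : ZMod q, (p : ZMod q) * k = -(j : ℕ) :=
      ⟨(p : ZMod q)⁻¹ * -(j : ℕ), by rw [← mul_assoc, ZMod.coe_mul_inv_eq_one p hpq, one_mul]⟩
    have h1 := h ⟨k.val, ZMod.val_lt _⟩
    rw [← h1]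
    refine Finset.sum_congr rfl fun s _ => ?_
    rw [hper]
    rw [← ZMod.intCast_zmod_eq_zero_iff_dvd]
    push_cast
    rw [ZMod.natCast_zmod_val, hk]
    simp

lemma zakForm_eq_zero_iff_vecMul (g : ℝ → ℂ) {α β δ : ℝ} {p q : ℕ} (hp : 0 < p)
    (hq : 0 < q) (hpq : p.Coprime q) (hαβ : α * β = (p : ℝ) / q) (hδ : p * δ = q * α) (x ξ : ℝ)
    (w : Fin p → ℂ) :
    zakForm g α δ p q
      (fun s => w (mulModEquiv hp hpq s) * expTwoPiI (-((q * s / p : ℕ) * (α * ξ)))) x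
        (q * (α * ξ)) = 0 ↔ w ᵥ* Qmat g α β p q x ξ = 0 := by
  rw [zakForm_eq_zero_iff g hq hpq, funext_iff]
  refine forall_congr' fun k => ?_
  rw [vecMul, dotProduct,
    ← (mulModEquiv hp hpq).sum_comp fun i => w i * Qmat g α β p q x ξ i k, Pi.zero_apply]
  refine Eq.congr_left (Finset.sum_congr rfl fun s _ => ?_)
  rw [unitZak_shift_eq_Qmat g hp hq hpq hαβ hδ, mul_assoc, ← mul_assoc (expTwoPiI _),
    ← expTwoPiI_add, neg_add_cancel, expTwoPiI_zero, one_mul]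

lemma nondegenerate_iff_det_ne_zero (g : ℝ → ℂ) {α β δ : ℝ} (hα : 0 < α) {p q : ℕ} (hp : 0 < p)
    (hq : 0 < q) (hpq : p.Coprime q) (hαβ : α * β = (p : ℝ) / q) (hδ : p * δ = q * α) :
    (∀ x τ v, zakForm g α δ p q v x τ = 0 → v = 0) ↔
      ∀ x ξ : ℝ, (Amat g α β p q x ξ).det ≠ 0 := by
  have hq' : (q : ℝ) ≠ 0 := by exact_mod_cast hq.ne'
  simp only [Amat, det_mul_conjTranspose_ne_zero_iff,
    ← zakForm_eq_zero_iff_vecMul g hp hq hpq hαβ hδ]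
  constructor
  · intro h x ξ w hw
    have h1 := h _ _ _ hw
    funext i
    have h2 := congrFun h1 ((mulModEquiv hp hpq).symm i)
    simpa [expTwoPiI_ne_zero] using h2
  · intro h x τ v hv
    have hτ : q * (α * (τ / (q * α))) = τ := by
      field_simp
    set ξ := τ / (q * α)
    have h1 := h x ξ (fun i => v ((mulModEquiv hp hpq).symm i) *
      expTwoPiI ((q * ((mulModEquiv hp hpq).symm i : ℕ) / p : ℕ) * (α * ξ))) (by
        rw [hτ]
        simpa [mul_assoc, ← expTwoPiI_add, expTwoPiI_zero] using hv)
    funext s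
    have h2 := congrFun h1 (mulModEquiv hp hpq s)
    simpa [expTwoPiI_ne_zero] using h2

theorem stmt_8 (g : ℝ → ℂ) (hgc : Continuous g)
    (α β : ℝ) (hα : 0 < α) (hβ : 0 < β)
    (hsum : Summable fun k : ℤ => ⨆ x ∈ Set.Icc (0 : ℝ) α, ‖g (x - α * k)‖)
    (hM1 : Integrable (fun z : ℝ × ℝ => ∫ t : ℝ, g t * (starRingEnd ℂ)
      (Complex.exp (2 * Real.pi * Complex.I * (z.2 * t)) * g (t - z.1)))
      (volume : Measure (ℝ × ℝ)))
    (p q : ℕ) (hp : 0 < p) (hq : 0 < q) (hpq : Nat.Coprime p q)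
    (hαβ : α * β = (p : ℝ) / q) :
    (GaborFrame g α β ↔
      ∀ x ξ : ℝ, (Amat g α β p q x ξ).det ≠ 0) ∧
    ((∀ x ξ : ℝ, (Amat g α β p q x ξ).det ≠ 0) ↔
      ∀ x ξ : ℝ, (Qmat g α β p q x ξ).rank = p) := by
  have hq' : (q : ℝ) ≠ 0 := by exact_mod_cast hq.ne'
  have hW := translatesDominated hgc hα hsum
  have hδ : (p : ℝ) * β⁻¹ = q * α := by
    field_simp at hαβ ⊢
    linarith
  have hββ : β * β⁻¹ = 1 := mul_inv_cancel₀ hβ.ne'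
  refine ⟨?_, forall₂_congr fun x ξ => det_mul_conjTranspose_ne_zero_iff_rank _⟩
  rw [← nondegenerate_iff_det_ne_zero g hα hp hq hpq hαβ hδ]
  exact ⟨nondegenerate_of_gaborFrame hgc hα hW hp hq hδ (inv_pos.2 hβ) hββ,
    gaborFrame_of_nondegenerate hgc (memLp_two_of_summable_iSup hgc hα hsum) hα hW hp hq hδ
      (inv_pos.2 hβ) hββ⟩
end
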